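/- arXiv:1406.0107 — 2 statements merged into one kernel-verified Lean document; each statement's English description precedes it below -/
import Mathlib

section
/- Let q be an odd prime power, d ≥ 2, and E ⊆ 𝔽_q^d with |E| > 12·q^{(d+1)/2}. Suppose t_1, …, t_k ∈ 𝔽_q are all nonzero and k < |E|/(12·q^{(d+1)/2}). Then ν_k(t⃗) > 0; that is, there exist x ∈ E and pairwise distinct x^1, …, x^k ∈ E with ‖x − x^i‖ = t_i for all 1 ≤ i ≤ k. -/
open Polynomial in
lemma bivar_zero {L : Type} [Field L] (r : ℕ) (P : L[X][X])
    (h : ∀ j, (P.coeff j).natDegree < r) (h0 : P.eval (X ^ r) = 0) : P = 0 := by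
  have key : ∀ j i, i < r → (P.eval (X ^ r)).coeff (r * j + i) = (P.coeff j).coeff i := by
    intro j i hi
    rw [eval_eq_sum_range, finsetSum_coeff]
    have : ∀ b ∈ Finset.range (P.natDegree + 1),
        (P.coeff b * (X ^ r) ^ b).coeff (r * j + i) = if b = j then (P.coeff j).coeff i else 0 := by
      intro b _
      rw [← pow_mul, coeff_mul_X_pow']
      rcases lt_trichotomy b j with hb | hb | hb
      · have h1 : r * (b + 1) ≤ r * j := Nat.mul_le_mul_left r hb
        rw [mul_add] at h1
        rw [if_pos (by omega), if_neg (by omega)]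
        apply coeff_eq_zero_of_natDegree_lt
        have := h b
        omega
      · subst hb
        rw [if_pos (by omega), if_pos rfl]
        congr 1; omega
      · have h1 : r * (j + 1) ≤ r * b := Nat.mul_le_mul_left r hb
        rw [mul_add] at h1
        rw [if_neg (by omega), if_neg (by omega)]
    rw [Finset.sum_congr rfl this, Finset.sum_ite_eq']
    split_ifs with hj
    · rfl
    · rw [coeff_eq_zero_of_natDegree_lt (p := P)]
      · simp
      · simp at hj; omega
  ext j i
  rw [coeff_zero, coeff_zero]
  by_cases hi : i < r
  · rw [← key j i hi, h0, coeff_zero]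
  · apply coeff_eq_zero_of_natDegree_lt
    have := h j; omega

open Polynomial in
lemma bideg_mul {L : Type} [Field L] (P Q : L[X][X]) (m n : ℕ)
    (hP : ∀ j, (P.coeff j).natDegree ≤ m) (hQ : ∀ j, (Q.coeff j).natDegree ≤ n) (j : ℕ) :
    ((P * Q).coeff j).natDegree ≤ m + n := by
  rw [coeff_mul]
  apply natDegree_sum_le_of_forall_le
  intro x _
  exact natDegree_mul_le.trans (add_le_add (hP _) (hQ _))

open Polynomial in
lemma step_nonzero {L : Type} [Field L] (p e h g : ℕ) [Fact p.Prime] [CharP L p]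
    (hr : p ^ e = 2 * h + 1) (hgh : g < h)
    (D : L[X]) (hDm : D.Monic) (hDdeg : D.natDegree = 2 * g)
    (hDns : ∀ a b : L[X], b ≠ 0 → D * b ^ 2 ≠ a ^ 2)
    (PA PB : L[X][X]) (hA : ∀ j, (PA.coeff j).natDegree ≤ h)
    (hB : ∀ j, (PB.coeff j).natDegree ≤ h - g - 1)
    (h0 : PA.eval (X ^ p ^ e) + D ^ (h + 1) * PB.eval (X ^ p ^ e) = 0) : PA = 0 ∧ PB = 0 := by
  set Ds : L[X] := D.map (iterateFrobenius L p e) with hDs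
  have hDs' : (Ds.map C).eval (X ^ p ^ e) = D ^ p ^ e := by
    rw [← map_iterateFrobenius_expand p D e, map_expand, expand_eq_comp_X_pow, eval_map]
    rfl
  have hP : C D * Ds.map C * (PB * PB) - PA * PA = 0 := by
    apply bivar_zero (p ^ e)
    · intro j
      rw [coeff_sub]
      refine lt_of_le_of_lt (natDegree_sub_le _ _) (max_lt ?_ ?_)
      · refine lt_of_le_of_lt (bideg_mul _ _ (2 * g + 0) ((h - g - 1) + (h - g - 1)) ?_ ?_ j) ?_
        · apply bideg_mul
          · intro j
            rw [coeff_C]; split_ifs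
            · omega
            · simp
          · intro j; simp
        · exact bideg_mul _ _ _ _ hB hB
        · omega
      · refine lt_of_le_of_lt (bideg_mul _ _ h h hA hA j) ?_
        omega
    · rw [eval_sub, eval_mul, eval_mul, eval_mul, eval_mul, eval_C, hDs']
      have h1 : PA.eval (X ^ p ^ e) = - (D ^ (h + 1) * PB.eval (X ^ p ^ e)) := by
        linear_combination h0
      rw [h1, hr]; ring
  by_cases hPB : PB = 0
  · refine ⟨?_, hPB⟩
    rw [hPB] at hP
    simpa using hP
  · exfalso
    have h2 : C D * Ds.map C * (PB * PB) = PA * PA := sub_eq_zero.1 hP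
    have h3 := congrArg leadingCoeff h2
    have hm : (Ds.map C).leadingCoeff = 1 := ((hDm.map _).map _).leadingCoeff
    rw [leadingCoeff_mul, leadingCoeff_mul, leadingCoeff_mul, leadingCoeff_mul, leadingCoeff_C, hm] at h3
    apply hDns PA.leadingCoeff PB.leadingCoeff (by simpa using hPB)
    linear_combination h3

open Polynomial in
lemma stepanov {L : Type} [Field L] [Fintype L] (p e h g : ℕ) [Fact p.Prime] [CharP L p]
    (hr : p ^ e = 2 * h + 1) (hcard : Fintype.card L = (p ^ e) ^ 2) (hgh : g < h)
    (hg1 : 1 ≤ g)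
    (D : L[X]) (hDm : D.Monic) (hDdeg : D.natDegree = 2 * g)
    (hDns : ∀ a b : L[X], b ≠ 0 → D * b ^ 2 ≠ a ^ 2) (ε : L)
    (S : Finset L) (hS : ∀ y ∈ S, D.eval y ^ ((2 * h + 2) * h) = ε) :
    2 * S.card ≤ (p ^ e) ^ 2 + 4 * g * p ^ e := by
  classical
  have : ExpChar L p := ExpChar.prime Fact.out
  set r := p ^ e with hrdef
  set J := h + g + 1 with hJ
  let V := (Fin J → degreeLT L (h + 1)) × (Fin J → degreeLT L (h - g))
  let Φ : V → L[X] := fun v => ∑ j : Fin J,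
    ((v.1 j : L[X]) ^ r + C ε * ((v.2 j : L[X]) ^ r * D ^ (h + 1))) * X ^ (j : ℕ)
  have ndA : ∀ n (f : degreeLT L (n + 1)), (f : L[X]).natDegree ≤ n := by
    intro n f
    have := f.2
    rw [mem_degreeLT] at this
    by_cases hf : (f : L[X]) = 0
    · simp [hf]
    · have := (natDegree_lt_iff_degree_lt hf).2 this
      omega
  obtain ⟨b, hb⟩ : ∃ b, h - g = b + 1 := ⟨h - g - 1, by omega⟩
  have dB : ∀ f : degreeLT L (h - g), (f : L[X]).natDegree ≤ b := by
    intro f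
    have := f.2
    rw [mem_degreeLT] at this
    by_cases hf : (f : L[X]) = 0
    · simp [hf]
    · have := (natDegree_lt_iff_degree_lt hf).2 this
      omega
  have hΦ : ∀ v, Φ v ∈ degreeLT L (r * h + J) := by
    intro v
    apply Submodule.sum_mem
    intro j _
    rw [mem_degreeLT]
    refine lt_of_le_of_lt (degree_le_of_natDegree_le (n := r * h + J - 1) ?_) ?_
    · refine natDegree_mul_le.trans ?_
      rw [natDegree_X_pow]
      have : ((v.1 j : L[X]) ^ r + C ε * ((v.2 j : L[X]) ^ r * D ^ (h + 1))).natDegree ≤ r * h := by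
        refine (natDegree_add_le _ _).trans (max_le ?_ ?_)
        · exact natDegree_pow_le.trans (Nat.mul_le_mul_left r (ndA h (v.1 j)))
        · refine natDegree_C_mul_le _ _ |>.trans (natDegree_mul_le.trans ?_)
          have h1 : ((v.2 j : L[X]) ^ r).natDegree ≤ r * b := by
            refine natDegree_pow_le.trans (Nat.mul_le_mul_left r ?_)
            exact dB _
          have h2 : (D ^ (h + 1)).natDegree ≤ (h + 1) * (2 * g) := by
            rw [← hDdeg]; exact natDegree_pow_le
          have h3 : h = b + 1 + g := by omega
          rw [hr] at *
          subst h3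
          nlinarith
      have := j.2
      omega
    · exact_mod_cast (by omega : r * h + J - 1 < r * h + J)
  have hcd : ∀ n, Nat.card (degreeLT L n) = (Fintype.card L) ^ n := by
    intro n
    rw [Nat.card_congr (degreeLTEquiv L n).toEquiv]
    simp [Nat.card_eq_fintype_card]
  have hfin : ∀ n, Finite (degreeLT L n) := fun n => Finite.of_equiv _ (degreeLTEquiv L n).toEquiv.symm
  have hni : ¬ Function.Injective (fun v => (⟨Φ v, hΦ v⟩ : degreeLT L (r * h + J))) := by
    intro hinj
    have h1 := Nat.card_le_card_of_injective _ hinj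
    rw [hcd, Nat.card_prod, Nat.card_fun, Nat.card_fun, hcd, hcd, Nat.card_eq_fintype_card,
      Fintype.card_fin, ← pow_mul, ← pow_mul, ← pow_add] at h1
    have h2 := (Nat.pow_le_pow_iff_right (Fintype.one_lt_card (α := L))).1 h1
    have h3 : h = b + 1 + g := by omega
    rw [hb, hJ, hr] at h2
    subst h3
    nlinarith
  have hni' : ∃ v w : V, Φ v = Φ w ∧ v ≠ w := by
    unfold Function.Injective at hni
    push Not at hni
    obtain ⟨v, w, h1, h2⟩ := hni
    exact ⟨v, w, congrArg Subtype.val h1, h2⟩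
  obtain ⟨v, w, hvw, hne⟩ := hni'
  set u : V := v - w with hu
  have hu0 : Φ u = 0 := by
    have : Φ u = Φ v - Φ w := by
      simp only [Φ, ← Finset.sum_sub_distrib]
      apply Finset.sum_congr rfl
      intro j _
      have e1 : ((u.1 j : L[X])) ^ r = (v.1 j : L[X]) ^ r - (w.1 j : L[X]) ^ r := by
        rw [hu, hrdef, ← sub_pow_char_pow]; rfl
      have e2 : ((u.2 j : L[X])) ^ r = (v.2 j : L[X]) ^ r - (w.2 j : L[X]) ^ r := by
        rw [hu, hrdef, ← sub_pow_char_pow]; rfl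
      rw [e1, e2]; ring
    rw [this, hvw, sub_self]
  let PA : L[X][X] := ∑ j : Fin J, monomial (j : ℕ) (u.1 j : L[X])
  let PB : L[X][X] := ∑ j : Fin J, monomial (j : ℕ) (u.2 j : L[X])
  have cf : ∀ (f : Fin J → L[X]) (j : ℕ), (∑ i : Fin J, monomial (i : ℕ) (f i)).coeff j =
      if hj : j < J then f ⟨j, hj⟩ else 0 := by
    intro f j
    rw [finsetSum_coeff]
    simp_rw [coeff_monomial]
    split_ifs with hj
    · rw [Finset.sum_eq_single ⟨j, hj⟩]
      · simp
      · intro b _ hb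
        rw [if_neg]
        intro h; apply hb; ext; exact h
      · simp
    · apply Finset.sum_eq_zero
      intro i _
      rw [if_neg]
      have := i.2; omega
  set G : L[X] := PA.eval (X ^ r) + D ^ (h + 1) * PB.eval (X ^ r) with hG
  have hPAe : PA.eval (X ^ r) = ∑ j : Fin J, (u.1 j : L[X]) * (X ^ r) ^ (j : ℕ) := by
    simp only [PA, eval_finsetSum, eval_monomial]
  have hPBe : PB.eval (X ^ r) = ∑ j : Fin J, (u.2 j : L[X]) * (X ^ r) ^ (j : ℕ) := by
    simp only [PB, eval_finsetSum, eval_monomial]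
  have hG0 : G ≠ 0 := by
    intro h0
    have := step_nonzero p e h g hr hgh D hDm hDdeg hDns PA PB ?_ ?_ h0
    · apply hne
      have hA0 := this.1
      have hB0 := this.2
      rw [← sub_eq_zero, ← hu]
      have a1 : ∀ j, u.1 j = 0 := by
        intro j
        have := cf (fun j => (u.1 j : L[X])) j
        rw [show (∑ i : Fin J, monomial (i : ℕ) ((fun j => (u.1 j : L[X])) i)) = 0 from hA0] at this
        simp at this
        exact Subtype.ext this.symm
      have a2 : ∀ j, u.2 j = 0 := by
        intro j
        have := cf (fun j => (u.2 j : L[X])) j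
        rw [show (∑ i : Fin J, monomial (i : ℕ) ((fun j => (u.2 j : L[X])) i)) = 0 from hB0] at this
        simp at this
        exact Subtype.ext this.symm
      exact Prod.ext (funext a1) (funext a2)
    · intro j
      rw [cf (fun j => (u.1 j : L[X])) j]
      split_ifs
      · exact ndA h _
      · simp
    · intro j
      rw [cf (fun j => (u.2 j : L[X])) j]
      split_ifs
      · exact (dB _).trans (by omega)
      · simp
  have hroots : ∀ y ∈ S, G.IsRoot y := by
    intro y hy
    have hyQ : (y ^ r) ^ r = y := by
      rw [← pow_mul, ← sq, ← hcard, FiniteField.pow_card]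
    have h1 : (G.eval y) ^ r = (Φ u).eval y := by
      have hrr : ∀ a c : L, (a + c) ^ r = a ^ r + c ^ r := fun a c => add_pow_char_pow _ _ _ _
      have hsum : ∀ f : Fin J → L, (∑ j, f j) ^ r = ∑ j, f j ^ r := fun f => sum_pow_char_pow _ _ _ _
      rw [hG, hPAe, hPBe, eval_add, eval_mul, eval_finsetSum, eval_finsetSum, hrr, mul_pow, hsum, hsum,
        Finset.mul_sum, ← Finset.sum_add_distrib]
      simp only [Φ, eval_finsetSum]
      apply Finset.sum_congr rfl
      intro j _
      simp only [eval_mul, eval_add, eval_pow, eval_C, eval_X, mul_pow]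
      rw [pow_right_comm _ (j : ℕ) r, hyQ, ← hS y hy]
      have : (eval y D ^ (h + 1)) ^ r = eval y D ^ ((2 * h + 2) * h) * eval y D ^ (h + 1) := by
        rw [← pow_mul, ← pow_add, hr]; congr 1; ring
      rw [this]; ring
    rw [hu0, eval_zero] at h1
    exact eq_zero_of_pow_eq_zero h1
  have hle : S.card ≤ G.natDegree := by
    apply Polynomial.card_le_degree_of_subset_roots
    intro y hy
    rw [mem_roots hG0]
    exact hroots y hy
  have hdeg : G.natDegree ≤ b + (h + 1) * (2 * g) + r * (h + g) := by
    rw [hG]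
    have hX : ∀ j : Fin J, ((X ^ r : L[X]) ^ (j : ℕ)).natDegree ≤ r * (h + g) := by
      intro j
      rw [← pow_mul, natDegree_X_pow]
      apply Nat.mul_le_mul_left
      have := j.2; omega
    refine (natDegree_add_le _ _).trans (max_le ?_ ?_)
    · rw [hPAe]
      apply natDegree_sum_le_of_forall_le
      intro j _
      refine natDegree_mul_le.trans ?_
      have := hX j
      have := ndA h (u.1 j)
      have : h ≤ b + (h + 1) * (2 * g) := by nlinarith
      omega
    · refine natDegree_mul_le.trans ?_
      have h2 : (D ^ (h + 1)).natDegree ≤ (h + 1) * (2 * g) := by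
        rw [← hDdeg]; exact natDegree_pow_le
      have h3 : (PB.eval (X ^ r)).natDegree ≤ b + r * (h + g) := by
        rw [hPBe]
        apply natDegree_sum_le_of_forall_le
        intro j _
        refine natDegree_mul_le.trans ?_
        have := hX j
        have := dB (u.2 j)
        omega
      omega
  have h3 : h = b + 1 + g := by omega
  have := hle.trans hdeg
  rw [hr] at *
  subst h3
  nlinarith
open Polynomial in
lemma quad_sum_bound {L : Type} [Field L] [Fintype L] [DecidableEq L] (p e e0 h : ℕ) [Fact p.Prime]
    [CharP L p] (he0 : e0 ≠ 0)
    (hr : p ^ e = 2 * h + 1) (hcard : Fintype.card L = (p ^ e) ^ 2) (hgh : p ^ e0 < h)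
    (c v : L) (hc : c ≠ 0) :
    |∑ y : L, quadraticChar L ((y ^ p ^ e0 - y + v) ^ 2 - 4 * c)| ≤ 6 * (p ^ e0 : ℕ) * (p ^ e : ℕ) := by
  set q := p ^ e0 with hq
  have hq1 : 1 < q := Nat.one_lt_pow he0 (Fact.out : p.Prime).one_lt
  have hodd : Fintype.card L % 2 = 1 := by
    rw [hcard, hr]; ring_nf; omega
  have hchar : ringChar L ≠ 2 := by
    intro h2
    have := FiniteField.even_card_iff_char_two.1 h2
    omega
  have h2 : (2 : L) ≠ 0 := Ring.two_ne_zero hchar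
  set H : L[X] := X ^ q - X + C v with hH
  set D : L[X] := H ^ 2 - C (4 * c) with hD
  have hHd : H.degree = q := by
    rw [hH, sub_add]
    rw [degree_sub_eq_left_of_degree_lt, degree_X_pow]
    rw [degree_X_pow]
    refine lt_of_le_of_lt (degree_sub_le _ _) ?_
    rw [degree_X]
    refine max_lt (by exact_mod_cast hq1) (lt_of_le_of_lt degree_C_le (by exact_mod_cast (by omega)))
  have hHm : H.Monic := by
    rw [hH, sub_add]
    apply monic_X_pow_sub
    refine lt_of_le_of_lt (degree_sub_le _ _) ?_
    rw [degree_X]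
    refine max_lt (by exact_mod_cast hq1) (lt_of_le_of_lt degree_C_le (by exact_mod_cast (by omega)))
  have hHn : H.natDegree = q := natDegree_eq_of_degree_eq_some hHd
  have hlt : (C (4 * c) : L[X]).degree < (H ^ 2).degree := by
    rw [degree_pow, hHd]
    refine lt_of_le_of_lt degree_C_le ?_
    simp; omega
  have hDm : D.Monic := (hHm.pow 2).sub_of_left hlt
  have hDd : D.natDegree = 2 * q := by
    rw [hD, natDegree_sub_C, natDegree_pow, hHn]
  have hH' : derivative H = -1 := by
    rw [hH, derivative_add, derivative_sub, derivative_X_pow, derivative_X, derivative_C]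
    have : ((q : ℕ) : L) = 0 := by
      rw [hq, Nat.cast_pow, CharP.cast_eq_zero, zero_pow he0]
    rw [this]; simp
  have hsep : D.Separable := by
    rw [separable_def]
    refine ⟨C (-(1 / (4 * c))), C (-(1 / (8 * c))) * H, ?_⟩
    have hD' : derivative D = - 2 * H := by
      rw [hD, derivative_sub, derivative_pow, derivative_C, hH']
      rw [show (C ((2 : ℕ) : L) : L[X]) = 2 by exact_mod_cast C_ofNat 2]
      ring
    rw [hD', hD]
    have e1 : (C (1 / (4 * c)) : L[X]) * C (4 * c) = 1 := by
      rw [← C_mul, one_div_mul_cancel, C_1]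
      rw [show (4 : L) = 2 * 2 by norm_num]
      simp [h2, hc]
    have e2 : (C (1 / (8 * c)) : L[X]) * 2 = C (1 / (4 * c)) := by
      rw [show (2 : L[X]) = C 2 from (C_ofNat 2).symm, ← C_mul]
      congr 1
      rw [show (8 : L) = 2 * 2 * 2 by norm_num, show (4 : L) = 2 * 2 by norm_num]
      field_simp
    rw [C_neg, C_neg]
    linear_combination e1 + H ^ 2 * e2
  have hDns : ∀ a b : L[X], b ≠ 0 → D * b ^ 2 ≠ a ^ 2 := by
    intro a b hb hab
    have hba : b ∣ a := by
      rw [← UniqueFactorizationMonoid.pow_dvd_pow_iff_dvd (n := 2) two_ne_zero]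
      exact ⟨D, by rw [← hab]; ring⟩
    obtain ⟨m, rfl⟩ := hba
    have hDm2 : D = m * m := by
      apply mul_right_cancel₀ (pow_ne_zero 2 hb)
      rw [hab]; ring
    have hu := hsep.squarefree m ⟨1, by rw [hDm2]; ring⟩
    have : IsUnit D := by rw [hDm2]; exact hu.mul hu
    have := natDegree_eq_zero_of_isUnit this
    omega
  have hev : ∀ y, D.eval y = (y ^ q - y + v) ^ 2 - 4 * c := by
    intro y; simp [hD, hH]
  have hhalf : Fintype.card L / 2 = (2 * h + 2) * h := by
    rw [hcard, hr]
    have : (2 * h + 1) ^ 2 = 2 * ((2 * h + 2) * h) + 1 := by ring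
    omega
  set χ : L → ℤ := fun y => quadraticChar L (D.eval y) with hχ
  have hbound : ∀ ε : ℤ, 2 * ((Finset.univ.filter (fun y => χ y = ε)).card : ℤ)
      ≤ (p ^ e : ℕ) ^ 2 + 4 * q * (p ^ e : ℕ) := by
    intro ε
    have := stepanov p e h q hr hcard hgh (by omega) D hDm hDd hDns (ε : L)
      (Finset.univ.filter (fun y => χ y = ε)) ?_
    · exact_mod_cast this
    · intro y hy
      rw [← hhalf, ← quadraticChar_eq_pow_of_char_ne_two' hchar]
      simp only [Finset.mem_filter, hχ] at hy
      rw [hy.2]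
  have hzero : ((Finset.univ.filter (fun y => χ y = 0)).card : ℤ) ≤ 2 * q := by
    have : (Finset.univ.filter (fun y => χ y = 0)).card ≤ D.natDegree := by
      apply card_le_degree_of_subset_roots
      intro y hy
      rw [mem_roots hDm.ne_zero]
      have := (Finset.mem_filter.1 hy).2
      exact quadraticChar_eq_zero_iff.1 this
    rw [hDd] at this
    exact_mod_cast this
  have hpt : ∀ y, χ y = 0 ∨ χ y = 1 ∨ χ y = -1 := fun y => quadraticChar_isQuadratic L _
  have hsum : ∑ y, χ y = ((Finset.univ.filter (fun y => χ y = 1)).card : ℤ)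
      - ((Finset.univ.filter (fun y => χ y = -1)).card : ℤ) := by
    rw [Finset.card_filter, Finset.card_filter]
    push_cast
    rw [← Finset.sum_sub_distrib]
    apply Finset.sum_congr rfl
    intro y _
    rcases hpt y with h | h | h <;> simp [h]
  have htot : ((p ^ e : ℕ) : ℤ) ^ 2 = ((Finset.univ.filter (fun y => χ y = 1)).card : ℤ)
      + ((Finset.univ.filter (fun y => χ y = -1)).card : ℤ)
      + ((Finset.univ.filter (fun y => χ y = 0)).card : ℤ) := by
    have : ((p ^ e : ℕ) : ℤ) ^ 2 = ∑ y : L, (1 : ℤ) := by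
      simp [hcard]
    rw [this, Finset.card_filter, Finset.card_filter, Finset.card_filter]
    push_cast
    rw [← Finset.sum_add_distrib, ← Finset.sum_add_distrib]
    apply Finset.sum_congr rfl
    intro y _
    rcases hpt y with h | h | h <;> simp [h]
  have hgoal : ∑ y : L, quadraticChar L ((y ^ q - y + v) ^ 2 - 4 * c) = ∑ y, χ y := by
    simp only [hχ, hev]
  rw [hgoal, hsum]
  have h1 := hbound 1
  have h3 := hbound (-1)
  have hr1 : (1 : ℤ) ≤ (p ^ e : ℕ) := by rw [hr]; push_cast; omega
  have hq2 : (1 : ℤ) ≤ q := by exact_mod_cast hq1.le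
  rw [abs_le]
  constructor <;> nlinarith

/-- The Kloosterman sum. -/
noncomputable def Kl {F : Type} [Field F] [Fintype F] [DecidableEq F] (ψ : AddChar F ℂ) (c : F) : ℂ :=
  ∑ x : F, if x = 0 then 0 else ψ (x + c * x⁻¹)

lemma kl_eq {F : Type} [Field F] [Fintype F] [DecidableEq F] (hF : ringChar F ≠ 2)
    (ψ : AddChar F ℂ) (hψ : ψ ≠ 1) (c : F) (hc : c ≠ 0) :
    Kl ψ c = ∑ u : F, ψ u * ((quadraticChar F (u ^ 2 - 4 * c) : ℤ) : ℂ) := by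
  have h2 : (2 : F) ≠ 0 := Ring.two_ne_zero hF
  have key : ∀ u : F, ((Finset.univ.filter (fun x : F => x ≠ 0 ∧ x + c * x⁻¹ = u)).card : ℤ)
      = quadraticChar F (u ^ 2 - 4 * c) + 1 := by
    intro u
    rw [← quadraticChar_card_sqrts hF]
    congr 1
    apply Finset.card_bij (fun x _ => 2 * x - u)
    · intro x hx
      obtain ⟨hx0, hx⟩ := (Finset.mem_filter.1 hx).2
      simp only [Set.mem_toFinset, Set.mem_ofPred_eq]
      rw [← hx]; field_simp; ring
    · intro x _ y _ hxy
      have : 2 * x = 2 * y := by linear_combination hxy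
      exact mul_left_cancel₀ h2 this
    · intro z hz
      simp only [Set.mem_toFinset, Set.mem_ofPred_eq] at hz
      have hx0 : (z + u) / 2 ≠ 0 := by
        intro h0
        have h1 : z = -u := by
          field_simp at h0; linear_combination h0
        rw [h1] at hz
        have : 4 * c = 0 := by linear_combination hz
        rw [show (4 : F) = 2 * 2 by norm_num] at this
        simp [h2, hc] at this
      refine ⟨(z + u) / 2, ?_, ?_⟩
      · simp only [Finset.mem_filter, Finset.mem_univ, true_and]
        refine ⟨hx0, ?_⟩
        have : ((z + u) / 2) * ((z + u) / 2 + c * ((z + u) / 2)⁻¹) = ((z + u) / 2) * u := by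
          rw [mul_add, mul_left_comm, mul_inv_cancel₀ hx0]
          field_simp
          linear_combination hz
        exact mul_left_cancel₀ hx0 this
      · field_simp; ring
  have e1 : Kl ψ c = ∑ u : F, ψ u *
      (((Finset.univ.filter (fun x : F => x ≠ 0 ∧ x + c * x⁻¹ = u)).card : ℤ) : ℂ) := by
    unfold Kl
    have : ∀ u : F, ψ u *
      (((Finset.univ.filter (fun x : F => x ≠ 0 ∧ x + c * x⁻¹ = u)).card : ℤ) : ℂ) =
       ∑ x : F, if x + c * x⁻¹ = u then (if x = 0 then 0 else ψ (x + c * x⁻¹)) else 0 := by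
      intro u
      rw [Finset.card_filter]
      push_cast
      rw [Finset.mul_sum]
      apply Finset.sum_congr rfl
      intro x _
      by_cases hx : x = 0
      · simp [hx]
      · by_cases hu : x + c * x⁻¹ = u
        · simp [hx, hu]
        · simp [hu]
    rw [Finset.sum_congr rfl (fun u _ => this u), Finset.sum_comm]
    apply Finset.sum_congr rfl
    intro x _
    rw [Finset.sum_ite_eq]
    simp
  rw [e1]
  have e2 : ∑ u : F, ψ u = 0 := AddChar.sum_eq_zero_of_ne_one hψ
  rw [← sub_eq_zero, ← Finset.sum_sub_distrib, ← e2]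
  apply Finset.sum_congr rfl
  intro u _
  rw [key]; push_cast; ring

lemma kl_crude {L : Type} [Field L] [Fintype L] [DecidableEq L] (p e e0 h : ℕ) [Fact p.Prime]
    [CharP L p] (he0 : e0 ≠ 0)
    (hr : p ^ e = 2 * h + 1) (hcard : Fintype.card L = (p ^ e) ^ 2) (hgh : p ^ e0 < h)
    (ψ : AddChar L ℂ) (hψ : ψ ≠ 1) (hinv : ∀ y, ψ (y ^ p ^ e0) = ψ y)
    (c : L) (hc : c ≠ 0) :
    ‖Kl ψ c‖ ≤ 6 * (p ^ e0 : ℕ) * (p ^ e : ℕ) := by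
  have hodd : Fintype.card L % 2 = 1 := by
    rw [hcard, hr]; ring_nf; omega
  have hchar : ringChar L ≠ 2 := by
    intro h2
    have := FiniteField.even_card_iff_char_two.1 h2
    omega
  rw [kl_eq hchar ψ hψ c hc]
  set f : L → ℂ := fun u => ψ u * ((quadraticChar L (u ^ 2 - 4 * c) : ℤ) : ℂ) with hf
  have h1 : ∀ y : L, ∑ u, f u = ∑ v, f (y ^ p ^ e0 - y + v) := by
    intro y
    exact (Equiv.sum_comp (Equiv.addLeft (y ^ p ^ e0 - y)) f).symm
  have h2 : (Fintype.card L : ℂ) * ∑ u, f u =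
      ∑ v, ψ v * ((∑ y : L, quadraticChar L ((y ^ p ^ e0 - y + v) ^ 2 - 4 * c) : ℤ) : ℂ) := by
    have : (Fintype.card L : ℂ) * ∑ u, f u = ∑ y : L, ∑ u, f u := by simp
    rw [this, Finset.sum_congr rfl (fun y _ => h1 y), Finset.sum_comm]
    apply Finset.sum_congr rfl
    intro v _
    push_cast
    rw [Finset.mul_sum]
    apply Finset.sum_congr rfl
    intro y _
    simp only [hf]
    congr 1
    rw [AddChar.map_add_eq_mul, AddChar.map_sub_eq_div, hinv, div_self, one_mul]
    exact (AddChar.val_isUnit ψ y).ne_zero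
  have hcp : (0 : ℝ) < Fintype.card L := by exact_mod_cast Fintype.card_pos
  have h3 : (Fintype.card L : ℝ) * ‖∑ u, f u‖ ≤ Fintype.card L * (6 * (p ^ e0 : ℕ) * (p ^ e : ℕ)) := by
    have : (Fintype.card L : ℝ) * ‖∑ u, f u‖ = ‖(Fintype.card L : ℂ) * ∑ u, f u‖ := by
      rw [norm_mul]; simp
    rw [this, h2]
    refine (norm_sum_le _ _).trans ?_
    refine (Finset.sum_le_card_nsmul _ _ (6 * (p ^ e0 : ℕ) * (p ^ e : ℕ) : ℝ) ?_).trans (by simp)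
    intro v _
    rw [norm_mul, AddChar.norm_apply, one_mul, Complex.norm_intCast]
    have := quad_sum_bound p e e0 h he0 hr hcard hgh c v hc
    exact_mod_cast this
  exact le_of_mul_le_mul_left h3 hcp

lemma sum_sq_comp {F : Type} [Field F] [Fintype F] [DecidableEq F] (hF : ringChar F ≠ 2)
    (g : F → ℂ) : ∑ v : F, g (v ^ 2) = ∑ w : F, ((quadraticChar F w : ℤ) + 1 : ℂ) * g w := by
  have h1 : ∀ w : F, ((quadraticChar F w : ℤ) + 1 : ℂ) * g w =
      ∑ v : F, if v ^ 2 = w then g (v ^ 2) else 0 := by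
    intro w
    have := quadraticChar_card_sqrts hF w
    have h2 : ((quadraticChar F w : ℤ) + 1 : ℂ) =
        ((Finset.univ.filter (fun v : F => v ^ 2 = w)).card : ℂ) := by
      have h3 : ((Finset.univ.filter (fun v : F => v ^ 2 = w)).card : ℤ) = quadraticChar F w + 1 := by
        rw [← this]; congr 2; ext; simp
      exact_mod_cast h3.symm
    rw [h2, Finset.card_filter]
    push_cast
    rw [Finset.sum_mul]
    apply Finset.sum_congr rfl
    intro v _
    split_ifs with h
    · rw [h, one_mul]
    · simp
  rw [Finset.sum_congr rfl (fun w _ => h1 w), Finset.sum_comm]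
  simp

lemma sum_sq_twist {F : Type} [Field F] [Fintype F] [DecidableEq F] (hF : ringChar F ≠ 2)
    (δ : F) (hδ : ¬ IsSquare δ) (g : F → ℂ) :
    ∑ v : F, g (δ * v ^ 2) + ∑ v : F, g (v ^ 2) = 2 * ∑ w : F, g w := by
  have hδ0 : δ ≠ 0 := by rintro rfl; exact hδ (IsSquare.zero)
  rw [sum_sq_comp hF g, sum_sq_comp hF (fun w => g (δ * w))]
  have : ∑ w : F, ((quadraticChar F w : ℤ) + 1 : ℂ) * g w =
      ∑ w : F, ((quadraticChar F (δ * w) : ℤ) + 1 : ℂ) * g (δ * w) :=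
    (Equiv.sum_comp (Equiv.mulLeft₀ δ hδ0) (fun w => ((quadraticChar F w : ℤ) + 1 : ℂ) * g w)).symm
  rw [this, ← Finset.sum_add_distrib]
  have h2 : ∑ w : F, g w = ∑ w : F, g (δ * w) := (Equiv.sum_comp (Equiv.mulLeft₀ δ hδ0) g).symm
  rw [h2, Finset.mul_sum]
  apply Finset.sum_congr rfl
  intro w _
  rw [map_mul, quadraticChar_neg_one_iff_not_isSquare.2 hδ]
  push_cast; ring

lemma kl_step {F : Type} [Field F] [Fintype F] [DecidableEq F] (hF : ringChar F ≠ 2)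
    (p e0 : ℕ) [Fact p.Prime] [CharP F p] (ψ : AddChar F ℂ) (hψ : ψ ≠ 1)
    (hinv : ∀ y, ψ (y ^ p ^ e0) = ψ y) (c : F) (hc : c ≠ 0) :
    ∃ (E : Type) (_ : Field E) (_ : Fintype E) (_ : DecidableEq E) (_ : CharP E p)
      (ψ' : AddChar E ℂ) (c' : E), ψ' ≠ 1 ∧ c' ≠ 0 ∧ (∀ y, ψ' (y ^ p ^ e0) = ψ' y) ∧
      Fintype.card E = Fintype.card F ^ 2 ∧ Kl ψ' c' = 2 * Fintype.card F - (Kl ψ c) ^ 2 := by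
  have h2 : (2 : F) ≠ 0 := Ring.two_ne_zero hF
  obtain ⟨δ, hδ⟩ := FiniteField.exists_nonsquare hF
  have hfact : Fact (∀ r : F, r ^ 2 ≠ δ + 0 * r) := ⟨by
    intro r hr
    apply hδ
    exact ⟨r, by linear_combination -hr⟩⟩
  let E := QuadraticAlgebra F δ 0
  letI : Fintype E := Fintype.ofEquiv _ (QuadraticAlgebra.equivProd δ 0).symm
  have : CharP E p := charP_of_injective_algebraMap (algebraMap F E).injective p
  letI : DecidableEq E := Classical.decEq E
  let tr : E →+ F := {
    toFun := fun z => 2 * z.re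
    map_zero' := mul_zero _
    map_add' := fun x y => mul_add 2 x.re y.re }
  let ψ' : AddChar E ℂ := ψ.compAddMonoidHom tr
  have hψ' : ∀ z : E, ψ' z = ψ (2 * z.re) := fun z => rfl
  have hsumE : ∀ f : E → ℂ, ∑ z : E, f z = ∑ u : F, ∑ v : F, f ⟨u, v⟩ := by
    intro f
    rw [← Fintype.sum_prod_type' (f := fun u v => f ⟨u, v⟩)]
    exact Fintype.sum_equiv (QuadraticAlgebra.equivProd δ 0) _ _ (fun z => rfl)
  refine ⟨E, inferInstance, inferInstance, inferInstance, inferInstance, ψ', algebraMap F E c,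
    ?_, ?_, ?_, ?_, ?_⟩
  · obtain ⟨a, ha⟩ := AddChar.ne_one_iff.1 hψ
    apply AddChar.ne_one_iff.2
    refine ⟨algebraMap F E (a / 2), ?_⟩
    rw [hψ']
    rw [show (algebraMap F E (a / 2)).re = a / 2 from rfl, mul_div_cancel₀ _ h2]
    exact ha
  · simpa using hc
  · intro y
    rw [hψ', hψ', ← hinv (2 * y.re)]
    congr 1
    have key : ∀ z : E, algebraMap F E (2 * z.re) = z + star z := by
      intro z
      have := QuadraticAlgebra.algebraMap_trace_eq_add_star (z := z)
      rw [QuadraticAlgebra.trace_def, zero_mul, add_zero] at this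
      exact this
    apply (algebraMap F E).injective
    rw [key, map_pow, key, star_pow, add_pow_char_pow]
  · rw [Fintype.card_congr (QuadraticAlgebra.equivProd δ 0), Fintype.card_prod, sq]
  · let T : F → F → ℂ := fun u w => if u ^ 2 = w then 0 else ψ (2 * u + 2 * c * u * (u ^ 2 - w)⁻¹)
    have hE : Kl ψ' (algebraMap F E c) = ∑ u : F, ∑ v : F, T u (δ * v ^ 2) := by
      unfold Kl
      rw [hsumE]
      apply Finset.sum_congr rfl
      intro u _
      apply Finset.sum_congr rfl
      intro v _
      have hn : QuadraticAlgebra.norm (⟨u, v⟩ : E) = u ^ 2 - δ * v ^ 2 := by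
        rw [QuadraticAlgebra.norm_def]; simp; ring
      have hz : (⟨u, v⟩ : E) = 0 ↔ u ^ 2 = δ * v ^ 2 := by
        rw [← QuadraticAlgebra.norm_eq_zero_iff_eq_zero, hn, sub_eq_zero]
      simp only [T]
      by_cases h : u ^ 2 = δ * v ^ 2
      · rw [if_pos (hz.2 h), if_pos h]
      · rw [if_neg (mt hz.1 h), if_neg h, hψ']
        congr 1
        have hinvz : (⟨u, v⟩ : E)⁻¹ = (QuadraticAlgebra.norm (⟨u, v⟩ : E))⁻¹ • star (⟨u, v⟩ : E) := rfl
        rw [hinvz, hn]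
        change 2 * (u + (c * ((u ^ 2 - δ * v ^ 2)⁻¹ * (u + 0 * v)) +
          δ * 0 * ((u ^ 2 - δ * v ^ 2)⁻¹ * (-v)))) = _
        ring
    have hK : Kl ψ c ^ 2 = ∑ u : F, ∑ v : F, T u (v ^ 2) := by
      unfold Kl
      rw [sq, Finset.sum_mul_sum, ← Fintype.sum_prod_type', ← Fintype.sum_prod_type']
      symm
      let eqv : F × F ≃ F × F :=
        { toFun := fun x => (x.1 + x.2, x.1 - x.2)
          invFun := fun x => ((x.1 + x.2) / 2, (x.1 - x.2) / 2)
          left_inv := by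
            intro x; ext <;> field_simp <;> ring
          right_inv := by
            intro x; ext <;> field_simp <;> ring }
      apply Fintype.sum_equiv eqv
      rintro ⟨u, v⟩
      simp only [T, eqv, Equiv.coe_fn_mk]
      by_cases h1 : u + v = 0
      · rw [if_pos h1, if_pos (by linear_combination (u - v) * h1), zero_mul]
      · by_cases h3 : u - v = 0
        · rw [if_pos h3, if_pos (by linear_combination (u + v) * h3), mul_zero]
        · have h4 : u ^ 2 - v ^ 2 ≠ 0 := by
            rw [show u ^ 2 - v ^ 2 = (u + v) * (u - v) by ring]
            exact mul_ne_zero h1 h3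
          rw [if_neg h1, if_neg h3, if_neg (sub_ne_zero.1 h4), ← AddChar.map_add_eq_mul]
          congr 1
          rw [show u ^ 2 - v ^ 2 = (u + v) * (u - v) by ring]
          field_simp
          ring
    rw [eq_sub_iff_add_eq, hE, hK, ← Finset.sum_add_distrib,
      Finset.sum_congr rfl (fun u _ => sum_sq_twist hF δ hδ (T u)), ← Finset.mul_sum]
    congr 1
    have h5 : ∀ u : F, ∑ w, T u w = ∑ n : F, if n = 0 then 0 else ψ (u * (2 * (1 + c * n⁻¹))) := by
      intro u
      apply Fintype.sum_equiv (Equiv.subLeft (u ^ 2))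
      intro w
      simp only [T, Equiv.subLeft_apply, sub_eq_zero]
      split_ifs
      · rfl
      · congr 1; ring
    rw [Finset.sum_congr rfl (fun u _ => h5 u), Finset.sum_comm, Finset.sum_eq_single (-c)]
    · rw [Finset.sum_congr rfl (fun u _ => if_neg (neg_ne_zero.2 hc))]
      have : 2 * (1 + c * (-c)⁻¹) = 0 := by field_simp; ring
      rw [this]; simp
    · intro n _ hn
      by_cases h0 : n = 0
      · simp [h0]
      · rw [Finset.sum_congr rfl (fun u _ => if_neg h0),
          AddChar.sum_mulShift _ (AddChar.IsPrimitive.of_ne_one hψ), if_neg]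
        · simp
        intro h6
        apply hn
        have : 1 + c * n⁻¹ = 0 := by simpa [h2] using h6
        field_simp at this
        linear_combination this
    · simp

lemma kl_tower {F : Type} [Field F] [Fintype F] [DecidableEq F]
    (p e0 : ℕ) (hp : p ≠ 2) [Fact p.Prime] [CharP F p] (hcard : Fintype.card F = p ^ e0)
    (ψ : AddChar F ℂ) (hψ : ψ ≠ 1)
    (c : F) (hc : c ≠ 0) (x : ℝ) (hx : 0 ≤ x)
    (hK : (2 + x) * Real.sqrt (Fintype.card F) ≤ ‖Kl ψ c‖) (n : ℕ) :
    ∃ (E : Type) (_ : Field E) (_ : Fintype E) (_ : DecidableEq E) (_ : CharP E p)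
      (ψ' : AddChar E ℂ) (c' : E), ψ' ≠ 1 ∧ c' ≠ 0 ∧ (∀ y, ψ' (y ^ p ^ e0) = ψ' y) ∧
      Fintype.card E = (p ^ e0) ^ (2 ^ n) ∧
      (2 + 4 ^ n * x) * Real.sqrt (Fintype.card E) ≤ ‖Kl ψ' c'‖ := by
  induction n with
  | zero =>
    refine ⟨F, inferInstance, inferInstance, inferInstance, inferInstance, ψ, c, hψ, hc, ?_, ?_, ?_⟩
    · intro y; rw [← hcard, FiniteField.pow_card]
    · simp [hcard]
    · simpa using hK
  | succ n ih =>
    obtain ⟨E, _, _, _, _, ψ', c', h1, h2, h3, h4, h5⟩ := ih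
    have hE : ringChar E ≠ 2 := by
      rwa [ringChar.eq E p]
    obtain ⟨E2, i1, i2, i3, i4, ψ2, c2, g1, g2, g3, g4, g5⟩ := kl_step hE p e0 ψ' h1 h3 c' h2
    refine ⟨E2, i1, i2, i3, i4, ψ2, c2, g1, g2, g3, ?_, ?_⟩
    · rw [g4, h4, ← pow_mul, pow_succ]
    · rw [g5, g4]
      push_cast
      rw [Real.sqrt_sq (by positivity)]
      set Q : ℝ := (Fintype.card E : ℝ) with hQ
      have hQ0 : 0 ≤ Q := by positivity
      have hs : Real.sqrt Q ^ 2 = Q := Real.sq_sqrt hQ0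
      set K := Kl ψ' c'
      have t1 : ‖K‖ ^ 2 - 2 * Q ≤ ‖2 * (Fintype.card E : ℂ) - K ^ 2‖ := by
        have := norm_sub_norm_le (K ^ 2) (2 * (Fintype.card E : ℂ))
        rw [norm_sub_rev, norm_pow, norm_mul, Complex.norm_natCast] at this
        simpa using this
      refine le_trans ?_ t1
      have t2 : ((2 + 4 ^ n * x) * Real.sqrt Q) ^ 2 ≤ ‖K‖ ^ 2 := by
        apply pow_le_pow_left₀ _ h5
        positivity
      rw [mul_pow, hs] at t2
      have : (2 + 4 ^ (n + 1) * x) * Q ≤ (2 + 4 ^ n * x) ^ 2 * Q - 2 * Q := by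
        have : 0 ≤ (4 ^ n * x) ^ 2 * Q := by positivity
        rw [pow_succ]
        nlinarith
      linarith

theorem kl_weil {F : Type} [Field F] [Fintype F] [DecidableEq F] (hodd : Odd (Fintype.card F))
    (ψ : AddChar F ℂ) (hψ : ψ ≠ 1) (c : F) (hc : c ≠ 0) :
    ‖Kl ψ c‖ ≤ 2 * Real.sqrt (Fintype.card F) := by
  by_contra hcon
  push Not at hcon
  obtain ⟨p, hpc⟩ := CharP.exists F
  obtain ⟨e1, hp, hcard⟩ := FiniteField.card F p
  obtain ⟨e0, he0⟩ := e1
  have he0n : e0 ≠ 0 := he0.ne'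
  replace hcard : Fintype.card F = p ^ e0 := hcard
  have : Fact p.Prime := ⟨hp⟩
  have hpodd : Odd p := by
    rw [hcard] at hodd
    exact (Nat.odd_pow_iff he0n).1 hodd
  have hp2 : p ≠ 2 := by rintro rfl; exact absurd hpodd (by decide)
  have hp3 : 3 ≤ p := by
    have := hp.two_le; omega
  set q := Fintype.card F with hq
  have hq3 : 3 ≤ q := by
    rw [hcard]
    exact hp3.trans (Nat.le_self_pow he0n p)
  have hs : 0 < Real.sqrt q := Real.sqrt_pos.2 (by exact_mod_cast (by omega : 0 < q))
  set x : ℝ := ‖Kl ψ c‖ / Real.sqrt q - 2 with hx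
  have hx0 : 0 < x := by
    rw [hx, sub_pos, lt_div_iff₀ hs]; exact hcon
  have hxK : (2 + x) * Real.sqrt q ≤ ‖Kl ψ c‖ := by
    rw [hx]
    rw [add_sub_cancel, div_mul_cancel₀ _ hs.ne']
  obtain ⟨n, hn⟩ : ∃ n : ℕ, 6 * (q : ℝ) / x < 4 ^ n := pow_unbounded_of_one_lt _ (by norm_num)
  obtain ⟨E, _, _, _, _, ψ', c', h1, h2, h3, h4, h5⟩ :=
    kl_tower p e0 hp2 hcard ψ hψ c hc x hx0.le hxK (n + 2)
  have hrodd : Odd (p ^ (e0 * 2 ^ (n + 1))) := hpodd.pow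
  obtain ⟨h, hh⟩ := hrodd
  have hcE : Fintype.card E = (p ^ (e0 * 2 ^ (n + 1) : ℕ)) ^ 2 := by
    rw [h4, ← pow_mul, ← pow_mul]; congr 1; ring
  have hqh : p ^ (e0 : ℕ) < h := by
    have h6 : (p ^ (e0 : ℕ)) ^ 2 ≤ p ^ (e0 * 2 ^ (n + 1) : ℕ) := by
      rw [← pow_mul]
      apply Nat.pow_le_pow_right (by omega)
      apply Nat.mul_le_mul_left
      rw [pow_succ]
      have : 1 ≤ 2 ^ n := Nat.one_le_two_pow
      omega
    rw [hh, ← hcard] at h6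
    rw [← hcard]
    nlinarith
  have h7 := kl_crude p (e0 * 2 ^ (n + 1)) e0 h he0n hh hcE hqh ψ' h1 h3 c' h2
  have h8 := h5.trans h7
  rw [hcE] at h8
  push_cast at h8
  rw [Real.sqrt_sq (by positivity)] at h8
  have h9 := le_of_mul_le_mul_right h8 (by positivity)
  have h10 : 6 * (q : ℝ) < 4 ^ n * x := by rwa [div_lt_iff₀ hx0] at hn
  have h11 : (q : ℝ) = (p : ℝ) ^ (e0 : ℕ) := by rw [hcard]; push_cast; rfl
  rw [← h11, pow_add] at h9
  nlinarith

lemma achar_sum {F ι : Type} [Field F] (ψ : AddChar F ℂ) (S : Finset ι) (f : ι → F) :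
    ψ (∑ j ∈ S, f j) = ∏ j ∈ S, ψ (f j) := by
  classical
  induction S using Finset.induction_on with
  | empty => simp
  | insert a S ha ih => rw [Finset.sum_insert ha, Finset.prod_insert ha, AddChar.map_add_eq_mul, ih]

lemma orth_sum {F : Type} [Field F] [Fintype F] [DecidableEq F] (ψ : AddChar F ℂ) (hψ : ψ ≠ 1)
    (d : ℕ) (z : Fin d → F) :
    ∑ m : Fin d → F, ψ (∑ j, m j * z j) = if z = 0 then (Fintype.card F : ℂ) ^ d else 0 := by
  have h1 : ∀ m : Fin d → F, ψ (∑ j, m j * z j) = ∏ j, ψ (m j * z j) := fun m =>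
    achar_sum _ _ _
  rw [Finset.sum_congr rfl (fun m _ => h1 m)]
  have h2 := Finset.prod_univ_sum (fun _ : Fin d => (Finset.univ : Finset F))
    (fun j a => ψ (a * z j))
  rw [Fintype.piFinset_univ] at h2
  rw [← h2]
  rw [Finset.prod_congr rfl (fun j _ => AddChar.sum_mulShift (z j) (AddChar.IsPrimitive.of_ne_one hψ))]
  split_ifs with h
  · simp [h]
  · obtain ⟨j, hj⟩ := Function.ne_iff.1 h
    exact Finset.prod_eq_zero (Finset.mem_univ j) (by rw [if_neg (show ¬ z j = 0 from hj)]; simp)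

noncomputable def ft {F : Type} [Field F] [Fintype F] (ψ : AddChar F ℂ) {d : ℕ}
    (B : Finset (Fin d → F)) (m : Fin d → F) : ℂ := ∑ x ∈ B, ψ (∑ j, m j * x j)

lemma ft_parseval {F : Type} [Field F] [Fintype F] [DecidableEq F] (ψ : AddChar F ℂ) (hψ : ψ ≠ 1)
    {d : ℕ} (B : Finset (Fin d → F)) :
    ∑ m, ‖ft ψ B m‖ ^ 2 = (Fintype.card F : ℝ) ^ d * B.card := by
  have h1 : ∀ m, ((‖ft ψ B m‖ ^ 2 : ℝ) : ℂ) = ∑ x ∈ B, ∑ y ∈ B, ψ (∑ j, m j * (x - y) j) := by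
    intro m
    rw [Complex.ofReal_pow, ← Complex.mul_conj']
    unfold ft
    rw [map_sum, Finset.sum_mul_sum]
    apply Finset.sum_congr rfl
    intro x _
    apply Finset.sum_congr rfl
    intro y _
    rw [← AddChar.map_neg_eq_conj, ← AddChar.map_add_eq_mul]
    congr 1
    rw [← Finset.sum_neg_distrib, ← Finset.sum_add_distrib]
    apply Finset.sum_congr rfl
    intro j _
    simp only [Pi.sub_apply]
    ring
  have h2 : ((∑ m, ‖ft ψ B m‖ ^ 2 : ℝ) : ℂ) = (Fintype.card F : ℂ) ^ d * B.card := by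
    rw [Complex.ofReal_sum, Finset.sum_congr rfl (fun m _ => h1 m), Finset.sum_comm]
    have : ∀ x ∈ B, ∑ m : Fin d → F, ∑ y ∈ B, ψ (∑ j, m j * (x - y) j) = (Fintype.card F : ℂ) ^ d := by
      intro x hx
      rw [Finset.sum_comm, Finset.sum_congr rfl (fun y _ => orth_sum ψ hψ d (x - y)),
        Finset.sum_eq_single x]
      · simp
      · intro y _ hy
        rw [if_neg]
        exact fun h => hy (sub_eq_zero.1 h).symm
      · exact fun h => absurd hx h
    rw [Finset.sum_congr rfl this]
    simp [mul_comm]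
  exact_mod_cast h2

lemma mixing {F : Type} [Field F] [Fintype F] [DecidableEq F] (ψ : AddChar F ℂ) (hψ : ψ ≠ 1)
    {d : ℕ} (B E : Finset (Fin d → F)) (k : (Fin d → F) → ℂ) (M : ℝ)
    (hM : ∀ m : Fin d → F, ‖∑ z, k z * ψ (∑ j, m j * z j)‖ ≤ M) :
    ‖∑ x ∈ B, ∑ y ∈ E, k (x - y)‖ ≤ M * (Real.sqrt B.card * Real.sqrt E.card) := by
  have hM0 : 0 ≤ M := (norm_nonneg _).trans (hM 0)
  set Q : ℝ := (Fintype.card F : ℝ) ^ d with hQ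
  have hQ0 : 0 < Q := by
    have : 0 < Fintype.card F := Fintype.card_pos
    positivity
  let kh : (Fin d → F) → ℂ := fun m => ∑ z, k z * ψ (∑ j, m j * z j)
  have key : (Q : ℂ) * ∑ x ∈ B, ∑ y ∈ E, k (x - y) =
      ∑ m, kh m * ((starRingEnd ℂ) (ft ψ B m) * ft ψ E m) := by
    have h1 : ∀ m, kh m * ((starRingEnd ℂ) (ft ψ B m) * ft ψ E m) =
        ∑ x ∈ B, ∑ y ∈ E, ∑ z, k z * ψ (∑ j, m j * (z - (x - y)) j) := by
      intro m
      unfold ft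
      rw [map_sum, Finset.sum_mul_sum, Finset.mul_sum]
      apply Finset.sum_congr rfl
      intro x _
      rw [Finset.mul_sum]
      apply Finset.sum_congr rfl
      intro y _
      simp only [kh]
      rw [Finset.sum_mul]
      apply Finset.sum_congr rfl
      intro z _
      rw [← AddChar.map_neg_eq_conj, ← AddChar.map_add_eq_mul, mul_assoc, ← AddChar.map_add_eq_mul]
      congr 2
      rw [← Finset.sum_neg_distrib, ← Finset.sum_add_distrib, ← Finset.sum_add_distrib]
      apply Finset.sum_congr rfl
      intro j _
      simp only [Pi.sub_apply]
      ring
    rw [Finset.sum_congr rfl (fun m _ => h1 m), Finset.sum_comm (s := Finset.univ), Finset.mul_sum]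
    apply Finset.sum_congr rfl
    intro x _
    rw [Finset.sum_comm, Finset.mul_sum]
    apply Finset.sum_congr rfl
    intro y _
    rw [Finset.sum_comm]
    rw [Finset.sum_congr rfl (fun z _ => (Finset.mul_sum _ _ _).symm)]
    rw [Finset.sum_congr rfl (fun z _ => by rw [orth_sum ψ hψ d (z - (x - y))])]
    rw [Finset.sum_eq_single (x - y)]
    · simp [hQ, mul_comm]
    · intro z _ hz
      rw [if_neg (sub_ne_zero.2 hz), mul_zero]
    · simp
  have h2 : Q * ‖∑ x ∈ B, ∑ y ∈ E, k (x - y)‖ ≤ M * ∑ m, ‖ft ψ B m‖ * ‖ft ψ E m‖ := by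
    have : Q * ‖∑ x ∈ B, ∑ y ∈ E, k (x - y)‖ = ‖(Q : ℂ) * ∑ x ∈ B, ∑ y ∈ E, k (x - y)‖ := by
      rw [norm_mul, Complex.norm_real, Real.norm_of_nonneg hQ0.le]
    rw [this, key, Finset.mul_sum]
    refine (norm_sum_le _ _).trans (Finset.sum_le_sum fun m _ => ?_)
    rw [norm_mul, norm_mul, RCLike.norm_conj]
    exact mul_le_mul_of_nonneg_right (hM m) (by positivity)
  have h3 := Real.sum_mul_le_sqrt_mul_sqrt Finset.univ (fun m => ‖ft ψ B m‖) (fun m => ‖ft ψ E m‖)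
  rw [ft_parseval ψ hψ, ft_parseval ψ hψ, ← hQ, Real.sqrt_mul hQ0.le, Real.sqrt_mul hQ0.le] at h3
  have h4 : Real.sqrt Q * Real.sqrt Q = Q := Real.mul_self_sqrt hQ0.le
  have h5 : Q * ‖∑ x ∈ B, ∑ y ∈ E, k (x - y)‖ ≤
      Q * (M * (Real.sqrt B.card * Real.sqrt E.card)) := by
    refine h2.trans ((mul_le_mul_of_nonneg_left h3 hM0).trans (le_of_eq ?_))
    linear_combination M * Real.sqrt B.card * Real.sqrt E.card * h4
  exact le_of_mul_le_mul_left h5 hQ0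

noncomputable def et {F : Type} [Field F] [Fintype F] [DecidableEq F] (s : F) : ℂ :=
  ((quadraticChar F s : ℤ) : ℂ)

noncomputable def Gs {F : Type} [Field F] [Fintype F] [DecidableEq F] (ψ : AddChar F ℂ) : ℂ :=
  ∑ u : F, et u * ψ u

lemma et_mul {F : Type} [Field F] [Fintype F] [DecidableEq F] (s t : F) :
    et (s * t) = et s * et t := by
  unfold et
  rw [map_mul]; push_cast; rfl

lemma et_sq {F : Type} [Field F] [Fintype F] [DecidableEq F] {s : F} (hs : s ≠ 0) :
    et s ^ 2 = 1 := by
  have := quadraticChar_sq_one hs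
  unfold et
  exact_mod_cast this

lemma et_norm {F : Type} [Field F] [Fintype F] [DecidableEq F] {s : F} (hs : s ≠ 0) :
    ‖et s‖ = 1 := by
  have h := congrArg norm (et_sq hs)
  rw [norm_pow, norm_one] at h
  exact (pow_eq_one_iff_of_nonneg (norm_nonneg _) two_ne_zero).1 h

lemma et_zero {F : Type} [Field F] [Fintype F] [DecidableEq F] : et (0 : F) = 0 := by
  simp [et]

lemma gs_norm {F : Type} [Field F] [Fintype F] [DecidableEq F] (hF : ringChar F ≠ 2)
    (ψ : AddChar F ℂ) (hψ : ψ ≠ 1) : ‖Gs ψ‖ ^ 2 = Fintype.card F := by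
  have h := gaussSum_sq (χ := (quadraticChar F).ringHomComp (Int.castRingHom ℂ)) (ψ := ψ)
    (by
      intro h
      obtain ⟨a, ha⟩ := quadraticChar_exists_neg_one hF
      have h0 : a ≠ 0 := by rintro rfl; simp at ha
      have h1 := congrFun (congrArg (fun f : MulChar F ℂ => (f : F → ℂ)) h) a
      simp only [MulChar.ringHomComp_apply, ha] at h1
      rw [MulChar.one_apply (Ne.isUnit h0)] at h1
      norm_num at h1)
    ((quadraticChar_isQuadratic F).comp _) (AddChar.IsPrimitive.of_ne_one hψ)
  have h2 : gaussSum ((quadraticChar F).ringHomComp (Int.castRingHom ℂ)) ψ = Gs ψ := rfl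
  rw [h2] at h
  have h3 := congrArg norm h
  rw [norm_pow, norm_mul] at h3
  have h4 : ‖((quadraticChar F).ringHomComp (Int.castRingHom ℂ)) (-1)‖ = 1 :=
    et_norm (F := F) (s := -1) (neg_ne_zero.2 one_ne_zero)
  rw [h4, one_mul, Complex.norm_natCast] at h3
  exact h3

lemma gs_norm' {F : Type} [Field F] [Fintype F] [DecidableEq F] (hF : ringChar F ≠ 2)
    (ψ : AddChar F ℂ) (hψ : ψ ≠ 1) : ‖Gs ψ‖ = Real.sqrt (Fintype.card F) := by
  rw [← gs_norm hF ψ hψ, Real.sqrt_sq (norm_nonneg _)]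

lemma quad_gauss {F : Type} [Field F] [Fintype F] [DecidableEq F] (hF : ringChar F ≠ 2)
    (ψ : AddChar F ℂ) (hψ : ψ ≠ 1) (s m : F) (hs : s ≠ 0) :
    ∑ z : F, ψ (s * z ^ 2 + m * z) = et s * Gs ψ * ψ (-(m ^ 2 * (4 * s)⁻¹)) := by
  have h2 : (2 : F) ≠ 0 := Ring.two_ne_zero hF
  have h4 : (4 : F) ≠ 0 := by
    rw [show (4 : F) = 2 * 2 by norm_num]; exact mul_ne_zero h2 h2
  have e1 : ∀ z : F, ψ (s * z ^ 2 + m * z) =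
      ψ (s * (z + m * (2 * s)⁻¹) ^ 2) * ψ (-(m ^ 2 * (4 * s)⁻¹)) := by
    intro z
    rw [← AddChar.map_add_eq_mul]
    congr 1
    field_simp
    ring
  rw [Finset.sum_congr rfl (fun z _ => e1 z), ← Finset.sum_mul]
  congr 1
  have e0 : ∑ z : F, ψ (s * (z + m * (2 * s)⁻¹) ^ 2) = ∑ z : F, ψ (s * z ^ 2) :=
    Equiv.sum_comp (Equiv.addRight (m * (2 * s)⁻¹)) (fun z => ψ (s * z ^ 2))
  rw [e0, sum_sq_comp hF (fun w => ψ (s * w))]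
  have e2 : Gs ψ = ∑ w, et (s * w) * ψ (s * w) :=
    (Equiv.sum_comp (Equiv.mulLeft₀ s hs) (fun w => et w * ψ w)).symm
  rw [e2, Finset.mul_sum]
  have e3 : ∑ w : F, ψ (s * w) = 0 := by
    have := AddChar.sum_mulShift s (AddChar.IsPrimitive.of_ne_one hψ)
    rw [if_neg hs] at this
    rw [← Nat.cast_zero, ← this]
    exact Finset.sum_congr rfl (fun w _ => by rw [mul_comm])
  have e4 : ∀ w : F, ((quadraticChar F w : ℤ) + 1 : ℂ) * ψ (s * w) =
      et s * (et (s * w) * ψ (s * w)) + ψ (s * w) := by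
    intro w
    rw [et_mul]
    have := et_sq hs
    change (et w + 1) * _ = _
    linear_combination (- et w * ψ (s * w)) * this
  rw [Finset.sum_congr rfl (fun w _ => e4 w), Finset.sum_add_distrib, e3, add_zero]

lemma salie_base {F : Type} [Field F] [Fintype F] [DecidableEq F] (hF : ringChar F ≠ 2)
    (ψ : AddChar F ℂ) (hψ : ψ ≠ 1) (N : F) :
    ‖∑ s : F, et s * ψ (-(s * N) - (4 * s)⁻¹)‖ ≤ 2 * Real.sqrt (Fintype.card F) := by
  set q := Fintype.card F with hq
  have hq0 : 0 < Real.sqrt q := Real.sqrt_pos.2 (by exact_mod_cast Fintype.card_pos)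
  have h1 : Gs ψ * ∑ s : F, et s * ψ (-(s * N) - (4 * s)⁻¹) =
      ∑ v : F, if v ^ 2 = N then (q : ℂ) * ψ v else 0 := by
    have e1 : ∀ v : F, (if v ^ 2 = N then (q : ℂ) * ψ v else 0) =
        ∑ s : F, ψ (-(s * N)) * ψ (s * v ^ 2 + 1 * v) := by
      intro v
      have := AddChar.sum_mulShift (v ^ 2 - N) (AddChar.IsPrimitive.of_ne_one hψ)
      have e2 : ∀ s : F, ψ (-(s * N)) * ψ (s * v ^ 2 + 1 * v) = ψ (s * (v ^ 2 - N)) * ψ v := by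
        intro s
        rw [← AddChar.map_add_eq_mul, ← AddChar.map_add_eq_mul]
        congr 1; ring
      rw [Finset.sum_congr rfl (fun s _ => e2 s), ← Finset.sum_mul, this]
      simp only [sub_eq_zero]
      split_ifs <;> simp [hq]
    rw [Finset.sum_congr rfl (fun v _ => e1 v), Finset.sum_comm, Finset.mul_sum]
    apply Finset.sum_congr rfl
    intro s _
    rw [← Finset.mul_sum]
    by_cases hs : s = 0
    · subst hs
      have := AddChar.sum_eq_zero_of_ne_one hψ
      simp [et_zero, this]
    · rw [quad_gauss hF ψ hψ s 1 hs, sub_eq_add_neg, AddChar.map_add_eq_mul, one_pow, one_mul]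
      ring
  have h2 : ‖∑ v : F, if v ^ 2 = N then (q : ℂ) * ψ v else 0‖ ≤ 2 * q := by
    rw [← Finset.sum_filter]
    refine (norm_sum_le _ _).trans ?_
    have : ∀ v ∈ Finset.univ.filter (fun v : F => v ^ 2 = N), ‖(q : ℂ) * ψ v‖ = q := by
      intro v _
      rw [norm_mul, AddChar.norm_apply, mul_one, Complex.norm_natCast]
    rw [Finset.sum_congr rfl this, Finset.sum_const, nsmul_eq_mul]
    have hc : (Finset.univ.filter (fun v : F => v ^ 2 = N)).card ≤ 2 := by
      have h3 : Finset.univ.filter (fun v : F => v ^ 2 = N) ⊆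
          (Polynomial.nthRoots 2 N).toFinset := by
        intro v hv
        rw [Multiset.mem_toFinset, Polynomial.mem_nthRoots two_pos]
        exact (Finset.mem_filter.1 hv).2
      exact (Finset.card_le_card h3).trans
        ((Multiset.toFinset_card_le _).trans (Polynomial.card_nthRoots 2 N))
    have : ((Finset.univ.filter (fun v : F => v ^ 2 = N)).card : ℝ) ≤ 2 := by exact_mod_cast hc
    exact mul_le_mul_of_nonneg_right this (by positivity)
  rw [← h1, norm_mul, gs_norm' hF ψ hψ, ← hq] at h2
  have h3 : Real.sqrt q * Real.sqrt q = q := Real.mul_self_sqrt (by positivity)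
  refine le_of_mul_le_mul_left (h2.trans (le_of_eq ?_)) hq0
  linear_combination -2 * h3

lemma twist_bound {F : Type} [Field F] [Fintype F] [DecidableEq F] (hodd : Odd (Fintype.card F))
    (hF : ringChar F ≠ 2)
    (ψ : AddChar F ℂ) (hψ : ψ ≠ 1) (d : ℕ) (hd : d ≠ 0) (t μ : F) (ht : t ≠ 0) :
    ‖∑ s : F, et s ^ d * ψ (-(s * t) - μ * s⁻¹)‖ ≤ 2 * Real.sqrt (Fintype.card F) := by
  have h2 : (2 : F) ≠ 0 := Ring.two_ne_zero hF
  have h4 : (4 : F) ≠ 0 := by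
    rw [show (4 : F) = 2 * 2 by norm_num]; exact mul_ne_zero h2 h2
  have hq1 : 1 ≤ Real.sqrt (Fintype.card F) := by
    rw [Real.one_le_sqrt]
    exact_mod_cast Fintype.card_pos
  rcases Nat.even_or_odd d with hde | hdo
  · have e1 : ∀ s : F, et s ^ d * ψ (-(s * t) - μ * s⁻¹) =
        if s = 0 then 0 else ψ (-(s * t) - μ * s⁻¹) := by
      intro s
      split_ifs with h
      · rw [h, et_zero, zero_pow hd, zero_mul]
      · obtain ⟨r, rfl⟩ := hde
        rw [← two_mul, pow_mul, et_sq h, one_pow, one_mul]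
    rw [Finset.sum_congr rfl (fun s _ => e1 s)]
    have hnt : -t ≠ 0 := neg_ne_zero.2 ht
    have e2 : ∑ s : F, (if s = 0 then 0 else ψ (-(s * t) - μ * s⁻¹)) = Kl ψ (t * μ) := by
      unfold Kl
      apply Fintype.sum_equiv (Equiv.mulRight₀ (-t) hnt)
      intro s
      simp only [Equiv.mulRight₀_apply, mul_eq_zero, hnt, or_false]
      split_ifs with h
      · rfl
      · congr 1
        field_simp
        ring
    rw [e2]
    by_cases hμ : μ = 0
    · have e3 : Kl ψ (t * μ) = -1 := by
        have h := AddChar.sum_eq_zero_of_ne_one hψ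
        unfold Kl
        rw [← Finset.add_sum_erase _ _ (Finset.mem_univ (0 : F))] at h ⊢
        rw [AddChar.map_zero_eq_one] at h
        rw [if_pos rfl, zero_add, eq_neg_iff_add_eq_zero, add_comm, ← h]
        congr 1
        apply Finset.sum_congr rfl
        intro x hx
        rw [if_neg (Finset.ne_of_mem_erase hx), hμ]
        simp
      rw [e3, norm_neg, norm_one]
      linarith
    · exact kl_weil hodd ψ hψ _ (mul_ne_zero ht hμ)
  · have e1 : ∀ s : F, et s ^ d = et s := by
      intro s
      by_cases h : s = 0
      · rw [h, et_zero, zero_pow hd]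
      · obtain ⟨r, rfl⟩ := hdo
        rw [pow_add, pow_mul, et_sq h, one_pow, one_mul, pow_one]
    have e2 : ∑ s : F, et s ^ d * ψ (-(s * t) - μ * s⁻¹) =
        et t * ∑ r : F, et r * ψ (-(r * (4 * t * μ)) - (4 * r)⁻¹) := by
      rw [Finset.mul_sum]
      have h4t : 4 * t ≠ 0 := mul_ne_zero h4 ht
      symm
      apply Fintype.sum_equiv ((Equiv.mulLeft₀ (4 * t) h4t).trans (Equiv.inv F))
      intro r
      rw [e1]
      simp only [Equiv.trans_apply, Equiv.mulLeft₀_apply, Equiv.inv_apply]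
      by_cases hr : r = 0
      · simp [hr, et_zero]
      · have : et (4 * t * r)⁻¹ = et t * et r := by
          have h5 : 4 * t * r ≠ 0 := mul_ne_zero h4t hr
          have h6 : et (4 * t * r) * et (4 * t * r)⁻¹ = 1 := by
            rw [← et_mul, mul_inv_cancel₀ h5]; simp [et]
          have h7 : et (4 * t * r) = et t * et r := by
            rw [et_mul, et_mul, show (4 : F) = 2 * 2 by norm_num, et_mul, ← sq, et_sq h2, one_mul]
          have h8 := et_sq ht
          have h9 := et_sq hr
          rw [h7] at h6
          have h10 : (et t * et r) ^ 2 = 1 := by rw [mul_pow, h8, h9, one_mul]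
          linear_combination (et t * et r) * h6 - et (4 * t * r)⁻¹ * h10
        rw [this, ← mul_assoc (et t) (et r)]
        congr 2
        field_simp
        ring
    rw [e2, norm_mul, et_norm ht, one_mul]
    exact salie_base hF ψ hψ _

lemma khat_bound {F : Type} [Field F] [Fintype F] [DecidableEq F] (hodd : Odd (Fintype.card F))
    (hF : ringChar F ≠ 2)
    (ψ : AddChar F ℂ) (hψ : ψ ≠ 1) (d : ℕ) (hd : d ≠ 0) (t : F) (ht : t ≠ 0) (m : Fin d → F) :
    ‖∑ z : Fin d → F, (∑ s : F, if s = 0 then 0 else ψ (s * (∑ j, z j ^ 2 - t))) *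
      ψ (∑ j, m j * z j)‖ ≤ 2 * Real.sqrt (Fintype.card F) ^ (d + 1) := by
  have h1 : ∑ z : Fin d → F, (∑ s : F, if s = 0 then 0 else ψ (s * (∑ j, z j ^ 2 - t))) *
      ψ (∑ j, m j * z j) =
      Gs ψ ^ d * ∑ s : F, et s ^ d * ψ (-(s * t) - ((∑ j, m j ^ 2) * 4⁻¹) * s⁻¹) := by
    rw [Finset.sum_congr rfl (fun z _ => Finset.sum_mul _ _ _), Finset.sum_comm, Finset.mul_sum]
    apply Finset.sum_congr rfl
    intro s _
    by_cases hs : s = 0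
    · simp [hs, et_zero, hd]
    · have e1 : ∀ z : Fin d → F, (if s = 0 then 0 else ψ (s * (∑ j, z j ^ 2 - t))) *
          ψ (∑ j, m j * z j) = ψ (-(s * t)) * ∏ j, ψ (s * z j ^ 2 + m j * z j) := by
        intro z
        rw [if_neg hs, ← achar_sum, ← AddChar.map_add_eq_mul, ← AddChar.map_add_eq_mul,
          Finset.sum_add_distrib, ← Finset.mul_sum]
        congr 1
        ring
      rw [Finset.sum_congr rfl (fun z _ => e1 z), ← Finset.mul_sum]
      have h2 := Finset.prod_univ_sum (fun _ : Fin d => (Finset.univ : Finset F))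
        (fun j a => ψ (s * a ^ 2 + m j * a))
      rw [Fintype.piFinset_univ] at h2
      rw [← h2, Finset.prod_congr rfl (fun j _ => quad_gauss hF ψ hψ s (m j) hs),
        Finset.prod_mul_distrib, ← achar_sum, Finset.prod_const, Finset.card_univ, Fintype.card_fin,
        sub_eq_add_neg, AddChar.map_add_eq_mul]
      have h3 : ∑ j, -(m j ^ 2 * (4 * s)⁻¹) = -((∑ j, m j ^ 2) * 4⁻¹ * s⁻¹) := by
        rw [Finset.sum_neg_distrib, ← Finset.sum_mul, mul_inv, mul_assoc]
      rw [h3]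
      ring
  rw [h1, norm_mul, norm_pow, gs_norm' hF ψ hψ]
  have := twist_bound hodd hF ψ hψ d hd t ((∑ j, m j ^ 2) * 4⁻¹) ht
  refine (mul_le_mul_of_nonneg_left this (by positivity)).trans (le_of_eq ?_)
  ring

def nb {F : Type} [Field F] [DecidableEq F] {d : ℕ} (E : Finset (Fin d → F)) (t : F)
    (x : Fin d → F) : Finset (Fin d → F) := E.filter (fun y => ∑ j, (x j - y j) ^ 2 = t)

lemma count_lower {F : Type} [Field F] [Fintype F] [DecidableEq F] (hodd : Odd (Fintype.card F))
    (hF : ringChar F ≠ 2) (d : ℕ) (hd : d ≠ 0) (t : F) (ht : t ≠ 0)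
    (B E : Finset (Fin d → F)) :
    (B.card : ℝ) * E.card - 2 * Real.sqrt (Fintype.card F) ^ (d + 1) *
      (Real.sqrt B.card * Real.sqrt E.card) ≤
      Fintype.card F * ∑ x ∈ B, ((nb E t x).card : ℝ) := by
  obtain ⟨ψ, hψp⟩ : ∃ ψ : AddChar F ℂ, ψ.IsPrimitive :=
    ⟨_, AddChar.FiniteField.primitiveChar_to_Complex_isPrimitive F⟩
  have hψ : ψ ≠ 1 := by
    have := hψp (a := 1) one_ne_zero
    rwa [AddChar.mulShift_one] at this
  let k : (Fin d → F) → ℂ := fun z => ∑ s : F, if s = 0 then 0 else ψ (s * (∑ j, z j ^ 2 - t))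
  have hm := mixing ψ hψ B E k _ (khat_bound hodd hF ψ hψ d hd t ht)
  have hk : ∀ z, k z = (if ∑ j, z j ^ 2 = t then (Fintype.card F : ℂ) else 0) - 1 := by
    intro z
    have h1 := AddChar.sum_mulShift (∑ j, z j ^ 2 - t) hψp
    simp only [sub_eq_zero] at h1
    have h2 : ∑ s : F, ψ (s * (∑ j, z j ^ 2 - t)) = k z + 1 := by
      simp only [k]
      rw [← Finset.add_sum_erase _ _ (Finset.mem_univ (0 : F)),
        ← Finset.add_sum_erase (Finset.univ) (fun s => if s = 0 then 0 else _) (Finset.mem_univ (0 : F))]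
      rw [zero_mul, AddChar.map_zero_eq_one, if_pos rfl, zero_add, add_comm]
      congr 1
      apply Finset.sum_congr rfl
      intro x hx
      rw [if_neg (Finset.ne_of_mem_erase hx)]
    rw [eq_sub_iff_add_eq, ← h2, h1]
    split_ifs <;> simp
  have hsum : ∑ x ∈ B, ∑ y ∈ E, k (x - y) =
      (((Fintype.card F : ℝ) * ∑ x ∈ B, ((nb E t x).card : ℝ) - B.card * E.card : ℝ) : ℂ) := by
    push_cast
    rw [Finset.mul_sum]
    have : (B.card * E.card : ℂ) = ∑ x ∈ B, (E.card : ℂ) := by simp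
    rw [this, ← Finset.sum_sub_distrib]
    apply Finset.sum_congr rfl
    intro x _
    rw [Finset.sum_congr rfl (fun y _ => hk (x - y)), Finset.sum_sub_distrib]
    congr 1
    · rw [← Finset.sum_filter]
      simp [nb, mul_comm]
    · simp
  rw [hsum, Complex.norm_real, Real.norm_eq_abs] at hm
  have := neg_le_of_abs_le hm
  linarith

theorem statement3 {F : Type} [Field F] [Fintype F] [DecidableEq F]
    (q : ℕ) (hq : Fintype.card F = q) (hodd : Odd q)
    (d : ℕ) (hd : 2 ≤ d) (k : ℕ)
    (E : Finset (Fin d → F))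
    (hE : 12 * (q : ℝ) ^ (((d : ℝ) + 1) / 2) < (E.card : ℝ))
    (hk : (k : ℝ) < (E.card : ℝ) / (12 * (q : ℝ) ^ (((d : ℝ) + 1) / 2)))
    (t : Fin k → F) (ht : ∀ i, t i ≠ 0) :
    ∃ x ∈ E, ∃ y : Fin k → (Fin d → F),
      Function.Injective y ∧ (∀ i, y i ∈ E) ∧
        ∀ i : Fin k, ∑ j, (x j - y i j) ^ 2 = t i := by
  have hF : ringChar F ≠ 2 := by
    intro h
    have := FiniteField.even_card_of_char_two h
    rw [hq] at this
    obtain ⟨r, hr⟩ := hodd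
    omega
  have hoddF : Odd (Fintype.card F) := hq ▸ hodd
  have hq1 : (1 : ℝ) ≤ q := by
    have : 0 < Fintype.card F := Fintype.card_pos
    rw [hq] at this
    exact_mod_cast this
  set R : ℝ := Real.sqrt q ^ (d + 1) with hR
  have hRq : (q : ℝ) ^ (((d : ℝ) + 1) / 2) = R := by
    rw [hR, Real.sqrt_eq_rpow, ← Real.rpow_natCast, ← Real.rpow_mul (by positivity)]
    congr 1
    push_cast
    ring
  rw [hRq] at hE hk
  have hs1 : 1 ≤ Real.sqrt q := by rwa [Real.one_le_sqrt]
  have hqR : (q : ℝ) ≤ R := by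
    calc (q : ℝ) = Real.sqrt q ^ 2 := (Real.sq_sqrt (by positivity)).symm
      _ ≤ R := pow_le_pow_right₀ hs1 (by omega)
  have hR0 : 0 < R := by positivity
  have hk' : (k : ℝ) * (12 * R) < E.card := by rwa [lt_div_iff₀ (by positivity)] at hk
  have hE0 : (0 : ℝ) < E.card := by linarith
  let B : Fin k → Finset (Fin d → F) := fun i => E.filter (fun x => (nb E (t i) x).card < k)
  have hB : ∀ i, ((B i).card : ℝ) * E.card ≤ 5 * R ^ 2 := by
    intro i
    have h1 := count_lower hoddF hF d (by omega) (t i) (ht i) (B i) E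
    rw [hq, ← hR] at h1
    have h2 : ∑ x ∈ B i, ((nb E (t i) x).card : ℝ) ≤ (B i).card * k := by
      refine (Finset.sum_le_card_nsmul _ _ (k : ℝ) ?_).trans (by rw [nsmul_eq_mul])
      intro x hx
      exact_mod_cast (Finset.mem_filter.1 hx).2.le
    have h3 : (q : ℝ) * k * 12 ≤ E.card := by
      have : (k : ℝ) * q ≤ k * R := mul_le_mul_of_nonneg_left hqR (by positivity)
      linarith
    have h4 : (q : ℝ) * ∑ x ∈ B i, ((nb E (t i) x).card : ℝ) ≤ (B i).card * E.card / 12 := by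
      have h5 := mul_le_mul_of_nonneg_left h2 (by positivity : (0 : ℝ) ≤ q)
      have h6 := mul_le_mul_of_nonneg_left h3 (by positivity : (0 : ℝ) ≤ (B i).card)
      linarith
    rw [← Real.sqrt_mul (by positivity)] at h1
    set X : ℝ := (B i).card * E.card with hX
    have hX0 : 0 ≤ X := by positivity
    have h7 : Real.sqrt X ^ 2 = X := Real.sq_sqrt hX0
    have h8 := Real.sqrt_nonneg X
    have h9 : 11 / 12 * Real.sqrt X ≤ 2 * R := by
      rcases h8.eq_or_lt with h | h
      · rw [← h]; linarith
      · refine le_of_mul_le_mul_right ?_ h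
        nlinarith
    nlinarith
  have hBs : ((Finset.univ.biUnion B).card : ℝ) < E.card := by
    rcases Nat.eq_zero_or_pos k with h0 | h0
    · subst h0
      simpa using hE0
    have h1 : ((Finset.univ.biUnion B).card : ℝ) ≤ ∑ i, ((B i).card : ℝ) := by
      exact_mod_cast Finset.card_biUnion_le
    have h2 : (∑ i, ((B i).card : ℝ)) * E.card ≤ k * (5 * R ^ 2) := by
      rw [Finset.sum_mul]
      refine (Finset.sum_le_card_nsmul _ _ _ (fun i _ => hB i)).trans (by simp)
    have h3 : ((Finset.univ.biUnion B).card : ℝ) * E.card < E.card * E.card := by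
      refine lt_of_le_of_lt ((mul_le_mul_of_nonneg_right h1 hE0.le).trans h2) ?_
      have h4 : (k : ℝ) * (12 * R) * R ≤ E.card * R := mul_le_mul_of_nonneg_right hk'.le hR0.le
      nlinarith
    exact lt_of_mul_lt_mul_right h3 hE0.le
  obtain ⟨x, hxE, hxB⟩ : ∃ x ∈ E, x ∉ Finset.univ.biUnion B := by
    by_contra hcon
    push Not at hcon
    have : E ⊆ Finset.univ.biUnion B := hcon
    have := Finset.card_le_card this
    have : (E.card : ℝ) ≤ (Finset.univ.biUnion B).card := by exact_mod_cast this
    linarith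
  have hdeg : ∀ i, k ≤ (nb E (t i) x).card := by
    intro i
    by_contra hlt
    exact hxB (Finset.mem_biUnion.2 ⟨i, Finset.mem_univ _,
      Finset.mem_filter.2 ⟨hxE, not_le.1 hlt⟩⟩)
  obtain ⟨y, hy, hym⟩ := (Finset.all_card_le_biUnion_card_iff_exists_injective
    (fun i : Fin k => nb E (t i) x)).1 (by
      intro S
      rcases S.eq_empty_or_nonempty with h | ⟨i, hi⟩
      · simp [h]
      · have h1 : S.card ≤ k := by simpa using Finset.card_le_univ S
        exact h1.trans ((hdeg i).trans (Finset.card_le_card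
          (Finset.subset_biUnion_of_mem (fun i : Fin k => nb E (t i) x) hi))))
  exact ⟨x, hxE, y, hy, fun i => (Finset.mem_filter.1 (hym i)).1,
    fun i => (Finset.mem_filter.1 (hym i)).2⟩
end

section
/- Let q be an odd prime power, d ≥ 2, t ∈ 𝔽_q nonzero, and f, g : 𝔽_q^d → ℝ≥0. Then ∑_{x,y ∈ 𝔽_q^d} f(x) g(y) 𝟙_{S_t}(x−y) = (|S_t|/q^d)·‖f‖_1·‖g‖_1 + D(f,g), where |D(f,g)| ≤ 2·q^{(d−1)/2}·‖f‖_2·‖g‖_2, with ‖f‖_1 = ∑_x f(x) and ‖f‖_2 = (∑_x f(x)^2)^{1/2}. -/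
set_option linter.unusedSectionVars false

namespace Bomb
open Polynomial
variable {E : Type} [Field E]

abbrev QR (h : E[X]) := QuadraticAlgebra E[X] h 0

noncomputable def e (h : E[X]) : ℕ ⊕ ℕ → QR h
  | .inl i => ⟨X ^ i, 0⟩
  | .inr i => ⟨0, X ^ i⟩

def o (D : ℕ) : ℕ ⊕ ℕ → ℕ
  | .inl i => 2 * i
  | .inr i => 2 * i + D

lemma o_inj {D : ℕ} (hD : Odd D) : Function.Injective (o D) := by
  obtain ⟨g, rfl⟩ := hD
  rintro (i | i) (j | j) hij <;> simp only [o] at hij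
  · congr 1; omega
  · omega
  · omega
  · congr 1; omega

noncomputable def Lt (h : E[X]) (m : ℕ) : Submodule E (QR h) where
  carrier := {z | (∀ i, m ≤ 2 * i → z.re.coeff i = 0) ∧
    (∀ i, m ≤ 2 * i + h.natDegree → z.im.coeff i = 0)}
  zero_mem' := by simp
  add_mem' := by
    rintro a b ⟨h1, h2⟩ ⟨h3, h4⟩
    exact ⟨fun i hi => by simp [h1 i hi, h3 i hi], fun i hi => by simp [h2 i hi, h4 i hi]⟩
  smul_mem' := by
    rintro c a ⟨h1, h2⟩
    exact ⟨fun i hi => by simp [h1 i hi], fun i hi => by simp [h2 i hi]⟩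

lemma mem_Lt {h : E[X]} {m : ℕ} {z : QR h} : z ∈ Lt h m ↔
    (∀ i, m ≤ 2 * i → z.re.coeff i = 0) ∧
    (∀ i, m ≤ 2 * i + h.natDegree → z.im.coeff i = 0) := Iff.rfl

lemma norm_eq {h : E[X]} (z : QR h) : z.norm = z.re ^ 2 - h * z.im ^ 2 := by
  rw [QuadraticAlgebra.norm_def]; ring

lemma norm_props {h : E[X]} (hD : Odd h.natDegree) (z : QR h) (hz : z ≠ 0) :
    z.norm ≠ 0 ∧ ∀ m, z ∈ Lt h m ↔ z.norm.natDegree < m := by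
  have hh : h ≠ 0 := by rintro rfl; simp at hD
  obtain ⟨A, B⟩ := z
  rw [norm_eq]
  simp only [mem_Lt]
  by_cases hA : A = 0
  · have hB : B ≠ 0 := by
      rintro rfl; apply hz; ext <;> simp [hA]
    subst hA
    have e1 : (h * B ^ 2).natDegree = 2 * B.natDegree + h.natDegree := by
      rw [natDegree_mul hh (pow_ne_zero _ hB), natDegree_pow]; ring
    refine ⟨by simpa using ⟨hh, hB⟩, fun m => ?_⟩
    simp only [ne_eq, OfNat.ofNat_ne_zero, not_false_eq_true, zero_pow, zero_sub, natDegree_neg, e1,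
      coeff_zero, implies_true, true_and]
    constructor
    · intro H
      by_contra hc
      have := H B.natDegree (by omega)
      simp [hB] at this
    · intro H i hi
      exact coeff_eq_zero_of_natDegree_lt (by omega)
  by_cases hB : B = 0
  · subst hB
    refine ⟨by simpa using hA, fun m => ?_⟩
    simp only [ne_eq, OfNat.ofNat_ne_zero, not_false_eq_true, zero_pow, mul_zero, sub_zero, natDegree_pow,
      coeff_zero, implies_true, and_true]
    constructor
    · intro H
      by_contra hc
      have := H A.natDegree (by omega)
      simp [hA] at this
    · intro H i hi
      exact coeff_eq_zero_of_natDegree_lt (by omega)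
  have e1 : (h * B ^ 2).natDegree = 2 * B.natDegree + h.natDegree := by
    rw [natDegree_mul hh (pow_ne_zero _ hB), natDegree_pow]; ring
  have e2 : (A ^ 2).natDegree = 2 * A.natDegree := natDegree_pow _ _
  have hne : 2 * A.natDegree ≠ 2 * B.natDegree + h.natDegree := by
    obtain ⟨g, hg⟩ := hD; omega
  have e3 : (A ^ 2 - h * B ^ 2).natDegree = max (2 * A.natDegree) (2 * B.natDegree + h.natDegree) := by
    rcases lt_or_gt_of_ne hne with hl | hl
    · rw [natDegree_sub_eq_right_of_natDegree_lt (by omega), e1]; omega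
    · rw [natDegree_sub_eq_left_of_natDegree_lt (by omega), e2]; omega
  refine ⟨?_, fun m => ?_⟩
  · intro h0
    rw [sub_eq_zero] at h0
    rw [h0, e1] at e2
    omega
  · rw [e3]
    constructor
    · rintro ⟨H1, H2⟩
      by_contra hc
      have := H1 A.natDegree
      have h2 := H2 B.natDegree
      simp only [coeff_natDegree, leadingCoeff_eq_zero, hA, hB, imp_false] at this h2
      omega
    · intro H
      exact ⟨fun i hi => coeff_eq_zero_of_natDegree_lt (by omega),
        fun i hi => coeff_eq_zero_of_natDegree_lt (by omega)⟩

lemma e_ne {h : E[X]} (s) : e h s ≠ 0 := by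
  rcases s with i | i <;> intro H
  · have := congrArg QuadraticAlgebra.re H
    simp [e] at this
  · have := congrArg QuadraticAlgebra.im H
    simp [e] at this

lemma norm_e {h : E[X]} (hD : Odd h.natDegree) (s) : (e h s).norm.natDegree = o h.natDegree s := by
  have hh : h ≠ 0 := by rintro rfl; simp at hD
  rcases s with i | i
  · simp [norm_eq, e, o]
  · simp only [norm_eq, e, o]
    rw [natDegree_sub]
    simp only [ne_eq, OfNat.ofNat_ne_zero, not_false_eq_true, zero_pow, sub_zero]
    rw [natDegree_mul hh (by simp), ← pow_mul, natDegree_X_pow]; ring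

lemma prod_props {h : E[X]} (hD : Odd h.natDegree) (s t) (a b : ℕ) :
    ((e h s) ^ a * (e h t) ^ b) ≠ 0 ∧
    ((e h s) ^ a * (e h t) ^ b).norm.natDegree = a * o h.natDegree s + b * o h.natDegree t := by
  have h1 := (norm_props hD _ (e_ne s)).1
  have h2 := (norm_props hD _ (e_ne t)).1
  constructor
  · intro H
    have := congrArg QuadraticAlgebra.norm H
    rw [map_mul, map_pow, map_pow, QuadraticAlgebra.norm_zero] at this
    exact mul_ne_zero (pow_ne_zero a h1) (pow_ne_zero b h2) this
  · rw [map_mul, map_pow, map_pow, natDegree_mul (pow_ne_zero a h1) (pow_ne_zero b h2),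
      natDegree_pow, natDegree_pow, norm_e hD, norm_e hD]

lemma indep {h : E[X]} (hD : Odd h.natDegree) {ι : Type} [Fintype ι] (v : ι → QR h)
    (hv : ∀ i, v i ≠ 0) (hinj : Function.Injective fun i => (v i).norm.natDegree)
    (c : ι → E) (hc : c ≠ 0) : ∑ i, c i • v i ≠ 0 := by
  classical
  intro H
  obtain ⟨i0, hi0⟩ := Function.ne_iff.1 hc
  have hne : (Finset.univ.filter fun i => c i ≠ 0).Nonempty := ⟨i0, by simpa using hi0⟩
  obtain ⟨k, hk, hmax⟩ := Finset.exists_max_image _ (fun i => (v i).norm.natDegree) hne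
  simp only [Finset.mem_filter, Finset.mem_univ, true_and] at hk hmax
  rw [← Finset.add_sum_erase _ _ (Finset.mem_univ k)] at H
  have hrest : ∑ i ∈ Finset.univ.erase k, c i • v i ∈ Lt h (v k).norm.natDegree := by
    refine Submodule.sum_mem _ fun i hi => ?_
    by_cases hci : c i = 0
    · simp [hci]
    refine Submodule.smul_mem _ _ (((norm_props hD _ (hv i)).2 _).2 ?_)
    refine lt_of_le_of_ne (hmax i hci) fun hh => (Finset.ne_of_mem_erase hi) (hinj hh)
  have : c k • v k ∈ Lt h (v k).norm.natDegree := by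
    rw [eq_neg_of_add_eq_zero_left H]
    exact Submodule.neg_mem _ hrest
  rw [Submodule.smul_mem_iff _ hk, (norm_props hD _ (hv k)).2] at this
  exact lt_irrefl _ this

noncomputable def ev (h : E[X]) (x w : E) (hw : w ^ 2 = h.eval x) : QR h →+* E where
  toFun z := z.re.eval x + z.im.eval x * w
  map_one' := by simp [QuadraticAlgebra.re_one, QuadraticAlgebra.im_one]
  map_zero' := by simp
  map_add' a b := by simp; ring
  map_mul' a b := by simp [← hw]; ring

lemma ev_smul (h : E[X]) (x w : E) (hw : w ^ 2 = h.eval x) (c : E) (z : QR h) :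
    ev h x w hw (c • z) = c * ev h x w hw z := by
  simp [ev]; ring

lemma card_zeros [Fintype E] [DecidableEq E] {h : E[X]} (hD : Odd h.natDegree) (h2 : (2 : E) ≠ 0)
    (z : QR h) (hz : z ≠ 0)
    (hv : ∀ x w (hw : w ^ 2 = h.eval x), ev h x w hw z = 0) :
    (Finset.univ.filter fun v : E × E => v.2 ^ 2 = h.eval v.1).card ≤ z.norm.natDegree := by
  have hN := (norm_props hD z hz).1
  have key : ∀ x : E, (Finset.univ.filter fun w : E => w ^ 2 = h.eval x).card ≤
      z.norm.roots.count x := by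
    intro x
    rw [count_roots]
    by_cases h0 : ∃ w, w ^ 2 = h.eval x
    · obtain ⟨w, hw⟩ := h0
      have hsub : (Finset.univ.filter fun w : E => w ^ 2 = h.eval x) ⊆ {w, -w} := by
        intro u hu
        simp only [Finset.mem_filter, Finset.mem_univ, true_and] at hu
        rw [← hw, sq_eq_sq_iff_eq_or_eq_neg] at hu
        simpa using hu
      have ha : z.re.eval x + z.im.eval x * w = 0 := hv x w hw
      have hb : z.re.eval x + z.im.eval x * (-w) = 0 := hv x (-w) (by rw [neg_sq, hw])
      by_cases hw0 : w = 0
      · subst hw0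
        refine (Finset.card_le_card hsub).trans ?_
        simp only [neg_zero, Finset.mem_singleton, Finset.insert_eq_of_mem, Finset.card_singleton]
        rw [Nat.one_le_iff_ne_zero, ← Nat.pos_iff_ne_zero, rootMultiplicity_pos hN, IsRoot.def, norm_eq]
        simp at ha hw
        simp [ha, ← hw]
      · have hA : z.re.eval x = 0 := by
          have : 2 * z.re.eval x = 0 := by linear_combination ha + hb
          simpa [h2] using this
        have hB : z.im.eval x = 0 := by
          rw [hA] at ha; simpa [hw0] using ha
        refine (Finset.card_le_card hsub).trans (Finset.card_le_two.trans ?_)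
        rw [le_rootMultiplicity_iff hN, norm_eq]
        have d1 := dvd_iff_isRoot.2 hA
        have d2 := dvd_iff_isRoot.2 hB
        exact dvd_sub (pow_dvd_pow_of_dvd d1 2) (Dvd.dvd.mul_left (pow_dvd_pow_of_dvd d2 2) _)
    · push Not at h0
      simp [h0]
  calc _ = ∑ x : E, (Finset.univ.filter fun w : E => w ^ 2 = h.eval x).card := by
        rw [Finset.card_filter, Fintype.sum_prod_type]
        refine Finset.sum_congr rfl fun x _ => ?_
        rw [Finset.card_filter]
    _ ≤ ∑ x : E, z.norm.roots.count x := Finset.sum_le_sum fun x _ => key x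
    _ = z.norm.roots.card := Multiset.sum_count_eq_card (by simp)
    _ ≤ _ := card_roots' _

theorem bombieri [Fintype E] [DecidableEq E] (p : ℕ) [hp : Fact p.Prime] [CharP E p] (k ρ g : ℕ)
    (hr : p ^ k = 2 * ρ + 1) (hQ : Fintype.card E = (2 * ρ + 1) ^ 2) (h : E[X])
    (hD : h.natDegree = 2 * g + 1) (h2 : (2 : E) ≠ 0) (hρ : g + (g + 1) ^ 2 ≤ 4 * ρ) (hgρ : g ≤ ρ) :
    (Finset.univ.filter fun v : E × E => v.2 ^ 2 = h.eval v.1).card ≤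
      (2 * ρ + 1) ^ 2 + (2 * g + 2) * (2 * ρ + 1) := by
  have hodd : Odd h.natDegree := ⟨g, hD⟩
  let J := Fin (ρ + 1) ⊕ Fin (ρ - g)
  let I := Fin (ρ + g + 2) ⊕ Fin (ρ + 1)
  let jj : J → ℕ ⊕ ℕ := Sum.map Fin.val Fin.val
  let ii : I → ℕ ⊕ ℕ := Sum.map Fin.val Fin.val
  have jinj : Function.Injective jj := Sum.map_injective.2 ⟨Fin.val_injective, Fin.val_injective⟩
  have iinj : Function.Injective ii := Sum.map_injective.2 ⟨Fin.val_injective, Fin.val_injective⟩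
  have hjo : ∀ j, o h.natDegree (jj j) ≤ 2 * ρ := by
    rintro (⟨j, hj⟩ | ⟨j, hj⟩) <;> simp only [jj, o, Sum.map_inl, Sum.map_inr] <;> omega
  have hio : ∀ j, o h.natDegree (ii j) ≤ 2 * (ρ + g + 1) := by
    rintro (⟨j, hj⟩ | ⟨j, hj⟩) <;> simp only [ii, o, Sum.map_inl, Sum.map_inr] <;> omega
  set r := 2 * ρ + 1 with hrdef
  let a := 2 * ρ ^ 2 + 2 * ρ + 2 + g
  let b := 2 * ρ ^ 2 + 2 * ρ + 1
  let G : (J × I → E) →ₗ[E] QR h :=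
    { toFun := fun c => ∑ s, c s • (e h (jj s.1) ^ r * e h (ii s.2) ^ 1)
      map_add' := fun c c' => by simp [add_smul, Finset.sum_add_distrib]
      map_smul' := fun c c' => by simp [mul_smul, Finset.smul_sum] }
  let T : QR h →ₗ[E] (Fin a → E) × (Fin b → E) :=
    { toFun := fun z => (fun i => z.re.coeff i, fun i => z.im.coeff i)
      map_add' := fun c c' => by ext <;> simp
      map_smul' := fun c c' => by ext <;> simp }
  have hGmem : ∀ c, G c ∈ Lt h (2 * a - 1) := by
    intro c
    refine Submodule.sum_mem _ fun s _ => Submodule.smul_mem _ _ ?_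
    have hp := prod_props hodd (jj s.1) (ii s.2) r 1
    rw [(norm_props hodd _ hp.1).2, hp.2]
    have h1 := hjo s.1
    have h2 := hio s.2
    have h3 : r * o h.natDegree (jj s.1) ≤ r * (2 * ρ) := Nat.mul_le_mul_left _ h1
    have h4 : r * (2 * ρ) = 2 * (2 * ρ ^ 2 + ρ) := by rw [hrdef]; ring
    simp only [a]
    omega
  have hker : ∃ c, c ≠ 0 ∧ (T ∘ₗ G) c = 0 := by
    have : LinearMap.ker (T ∘ₗ G) ≠ ⊥ := by
      apply LinearMap.ker_ne_bot_of_finrank_lt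
      simp only [Module.finrank_prod, Module.finrank_fintype_fun_eq_card, Fintype.card_fin,
        Fintype.card_prod, Fintype.card_sum, J, I, a, b]
      obtain ⟨t, rfl⟩ := Nat.exists_eq_add_of_le hgρ
      rw [Nat.add_sub_cancel_left]
      nlinarith
    obtain ⟨c, hc, hc0⟩ := (Submodule.ne_bot_iff _).1 this
    exact ⟨c, hc0, hc⟩
  obtain ⟨c, hc0, hTc⟩ := hker
  have hGc : G c = 0 := by
    have hm := mem_Lt.1 (hGmem c)
    have h1 : ∀ i : Fin a, (G c).re.coeff i = 0 := fun i => congrFun (congrArg Prod.fst hTc) i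
    have h2 : ∀ i : Fin b, (G c).im.coeff i = 0 := fun i => congrFun (congrArg Prod.snd hTc) i
    apply QuadraticAlgebra.ext
    · ext i
      rcases lt_or_ge i a with hi | hi
      · simpa using h1 ⟨i, hi⟩
      · simpa using hm.1 i (by omega)
    · ext i
      rcases lt_or_ge i b with hi | hi
      · simpa using h2 ⟨i, hi⟩
      · simpa using hm.2 i (by simp only [a, b] at *; omega)
  have hfrob : Function.Surjective (iterateFrobenius E p k) := (bijective_iterateFrobenius E p k).2
  choose c' hc' using fun s => hfrob (c s)
  simp only [iterateFrobenius_def, hr] at hc'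
  have hc'0 : c' ≠ 0 := by
    rintro rfl
    apply hc0
    ext s
    rw [← hc' s]; simp [hrdef]
  let H : QR h := ∑ s : J × I, c' s • (e h (jj s.1) ^ 1 * e h (ii s.2) ^ r)
  have hH : H ≠ 0 := by
    apply indep hodd _ (fun s => (prod_props hodd _ _ _ _).1) _ c' hc'0
    rintro ⟨j, i⟩ ⟨j', i'⟩ hs
    simp only [(prod_props hodd _ _ _ _).2] at hs
    have h1 := hjo j
    have h2 := hjo j'
    have hi : o h.natDegree (ii i) = o h.natDegree (ii i') := by
      rcases lt_trichotomy (o h.natDegree (ii i)) (o h.natDegree (ii i')) with hl | hl | hl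
      · have := Nat.mul_le_mul_left r (Nat.succ_le_of_lt hl)
        rw [Nat.mul_succ] at this; omega
      · exact hl
      · have := Nat.mul_le_mul_left r (Nat.succ_le_of_lt hl)
        rw [Nat.mul_succ] at this; omega
    rw [hi] at hs
    have hj : o h.natDegree (jj j) = o h.natDegree (jj j') := by omega
    exact Prod.ext (jinj (o_inj hodd hj)) (iinj (o_inj hodd hi))
  have hHd : H.norm.natDegree < r + r * (2 * (ρ + g + 1)) := by
    rw [← (norm_props hodd _ hH).2]
    refine Submodule.sum_mem _ fun s _ => Submodule.smul_mem _ _ ?_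
    have hp := prod_props hodd (jj s.1) (ii s.2) 1 r
    rw [(norm_props hodd _ hp.1).2, hp.2]
    have h1 := hjo s.1
    have h2 := Nat.mul_le_mul_left r (hio s.2)
    omega
  have hcz := card_zeros hodd h2 H hH (by
    intro x w hw
    have hz : (ev h x w hw H) ^ r = 0 := by
      have hsum : (ev h x w hw H) ^ r = ∑ s : J × I, (ev h x w hw (c' s • (e h (jj s.1) ^ 1 * e h (ii s.2) ^ r))) ^ r := by
        rw [map_sum, ← hr]
        exact sum_pow_char_pow p k _ _
      rw [hsum, ← map_zero (ev h x w hw), ← hGc]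
      change _ = ev h x w hw (∑ s, c s • (e h (jj s.1) ^ r * e h (ii s.2) ^ 1))
      rw [map_sum]
      refine Finset.sum_congr rfl fun s _ => ?_
      rw [ev_smul, ev_smul, mul_pow, hc', map_mul, map_mul, mul_pow, map_pow, map_pow, map_pow, map_pow, ← pow_mul, ← pow_mul,
        one_mul, pow_one, ← pow_two, ← hQ, FiniteField.pow_card]
    exact pow_eq_zero_iff (by omega) |>.1 hz)
  refine hcz.trans (hHd.le.trans ?_)
  rw [hrdef]; nlinarith
end Bomb


namespace LF
open Polynomial
variable {F : Type} [Field F] [Fintype F] [DecidableEq F]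

noncomputable def mk (n : ℕ) (c : Fin n → F) : F[X] := X ^ n + ∑ i : Fin n, C (c i) * X ^ (i : ℕ)

lemma deg_sum {n : ℕ} (c : Fin n → F) : (∑ i : Fin n, C (c i) * X ^ (i : ℕ) : F[X]).degree < n := by
  refine (degree_sum_le _ _).trans_lt ?_
  refine (Finset.sup_lt_iff (WithBot.bot_lt_coe n)).2 fun i _ => ?_
  refine (degree_C_mul_X_pow_le _ _).trans_lt ?_
  exact WithBot.coe_lt_coe.2 i.2

lemma mk_monic {n : ℕ} (c : Fin n → F) : (mk n c).Monic :=
  monic_X_pow_add (deg_sum c)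

lemma mk_natDegree {n : ℕ} (c : Fin n → F) : (mk n c).natDegree = n := by
  apply natDegree_eq_of_degree_eq_some
  rw [mk, degree_add_eq_left_of_degree_lt] <;> rw [degree_X_pow]
  exact deg_sum c

lemma mk_coeff {n : ℕ} (c : Fin n → F) (i : Fin n) : (mk n c).coeff i = c i := by
  simp only [mk, coeff_add, coeff_X_pow, finsetSum_coeff, coeff_C_mul]
  rw [if_neg (by omega), Finset.sum_eq_single i]
  · simp
  · intro b _ hb
    rw [if_neg (fun h => hb (Fin.ext h.symm)), mul_zero]
  · simp

lemma mk_inj (n : ℕ) : Function.Injective (mk (F := F) n) := by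
  intro c c' h
  ext i
  rw [← mk_coeff c i, h, mk_coeff]

open scoped Classical in
noncomputable def Mon (F : Type) [Field F] [Fintype F] [DecidableEq F] (n : ℕ) : Finset F[X] := Finset.univ.image (mk (F := F) n)

lemma mem_Mon {n : ℕ} {f : F[X]} : f ∈ Mon F n ↔ f.Monic ∧ f.natDegree = n := by
  simp only [Mon, Finset.mem_image, Finset.mem_univ, true_and]
  constructor
  · rintro ⟨c, rfl⟩
    exact ⟨mk_monic c, mk_natDegree c⟩
  · rintro ⟨h1, h2⟩
    refine ⟨fun i => f.coeff i, ?_⟩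
    ext i
    rcases lt_trichotomy i n with hi | hi | hi
    · exact mk_coeff _ ⟨i, hi⟩
    · subst hi
      have := (mk_monic (n := i) (fun j => f.coeff j)).coeff_natDegree
      rw [mk_natDegree] at this
      rw [this, ← h2, h1.coeff_natDegree]
    · rw [coeff_eq_zero_of_natDegree_lt (by rw [mk_natDegree]; exact hi),
        coeff_eq_zero_of_natDegree_lt (by omega)]

variable (ψ : AddChar F ℂ) (a b : F)

noncomputable def lam (f : F[X]) : ℂ :=
  if f.coeff 0 = 0 then 0 else ψ (-(a * f.nextCoeff + b * (f.coeff 1 / f.coeff 0)))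

lemma lam_mul {f g : F[X]} (hf : f.Monic) (hg : g.Monic) :
    lam ψ a b (f * g) = lam ψ a b f * lam ψ a b g := by
  unfold lam
  rw [mul_coeff_zero]
  by_cases h1 : f.coeff 0 = 0
  · simp [h1]
  by_cases h2 : g.coeff 0 = 0
  · simp [h2]
  rw [if_neg (mul_ne_zero h1 h2), if_neg h1, if_neg h2, ← AddChar.map_add_eq_mul,
    hf.nextCoeff_mul hg, mul_coeff_one]
  congr 1
  field_simp
  ring

lemma lam_one : lam ψ a b 1 = 1 := by
  simp [lam, coeff_one, nextCoeff]

lemma lam_pow {f : F[X]} (hf : f.Monic) (j : ℕ) : lam ψ a b (f ^ j) = lam ψ a b f ^ j := by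
  induction j with
  | zero => simp [lam_one]
  | succ j ih => rw [pow_succ, lam_mul _ _ _ (hf.pow j) hf, ih, pow_succ]

noncomputable def A (n : ℕ) : ℂ := ∑ f ∈ Mon F n, lam ψ a b f

lemma A_eq (n : ℕ) : A ψ a b n = ∑ c : Fin n → F, lam ψ a b (mk n c) := by
  classical
  rw [A, Mon, Finset.sum_image]
  · rintro x _ y _ h; exact mk_inj n h

lemma A_zero : A ψ a b 0 = 1 := by
  rw [A_eq]; simp [mk, lam_one]

lemma A_one : A ψ a b 1 = ∑ x : F, if x = 0 then 0 else ψ (a * x + b * x⁻¹) := by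
  rw [A_eq, ← (Equiv.funUnique (Fin 1) F).symm.sum_comp, ← Equiv.sum_comp (Equiv.neg F)]
  refine Finset.sum_congr rfl fun x _ => ?_
  have h1 : mk 1 ((Equiv.funUnique (Fin 1) F).symm (Equiv.neg F x)) = X - C x := by
    simp [mk, sub_eq_add_neg]
  rw [h1, lam, nextCoeff_X_sub_C]
  by_cases hx : x = 0
  · simp [hx]
  · simp [hx, coeff_X, coeff_C, div_eq_mul_inv]
    congr 1
    ring

variable {ψ a b}

lemma A_two (hψ : ψ.IsPrimitive) (ha : a ≠ 0) (hb : b ≠ 0) :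
    A ψ a b 2 = Fintype.card F := by
  rw [A_eq, ← (finTwoArrowEquiv F).symm.sum_comp, Fintype.sum_prod_type]
  have key : ∀ x y : F, lam ψ a b (mk 2 ((finTwoArrowEquiv F).symm (x, y))) =
      if x = 0 then 0 else ψ (y * -(a + b * x⁻¹)) := by
    intro x y
    have h0 := mk_coeff ((finTwoArrowEquiv F).symm (x, y)) 0
    have h1 := mk_coeff ((finTwoArrowEquiv F).symm (x, y)) 1
    simp only [Fin.val_zero, Fin.val_one, finTwoArrowEquiv_symm_apply, Matrix.cons_val_zero, Matrix.cons_val_one] at h0 h1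
    rw [lam, nextCoeff_of_natDegree_pos (by rw [mk_natDegree]; norm_num), mk_natDegree]
    simp only [finTwoArrowEquiv_symm_apply, Nat.add_one_sub_one, h0, h1]
    split_ifs
    · rfl
    · congr 1; rw [div_eq_mul_inv]; ring
  simp only [key]
  have : ∀ x : F, (∑ y : F, if x = 0 then (0 : ℂ) else ψ (y * -(a + b * x⁻¹))) =
      if x = - b / a then (Fintype.card F : ℂ) else 0 := by
    intro x
    by_cases hx : x = 0
    · rw [if_neg (by rw [hx]; exact (div_ne_zero (neg_ne_zero.2 hb) ha).symm)]
      simp [hx]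
    simp only [hx, if_false]
    rw [AddChar.sum_mulShift _ hψ]
    have : -(a + b * x⁻¹) = 0 ↔ x = - b / a := by
      rw [neg_eq_zero, eq_div_iff ha]
      constructor
      · intro h; field_simp at h; linear_combination h
      · intro h; field_simp; linear_combination h
    simp only [this]
    split_ifs <;> simp
  simp only [this]
  simp

lemma A_big (hψ : ψ.IsPrimitive) (ha : a ≠ 0) {n : ℕ} (hn : 3 ≤ n) : A ψ a b n = 0 := by
  obtain ⟨y, hy⟩ : ∃ y, ψ y ≠ 1 := AddChar.ne_one_iff.1 (by simpa [AddChar.mulShift_one] using hψ one_ne_zero)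
  let δ : Fin n → F := Pi.single ⟨n - 1, by omega⟩ (- y / a)
  have h : A ψ a b n = ψ y * A ψ a b n := by
    rw [A_eq, Finset.mul_sum, ← Equiv.sum_comp (Equiv.addRight δ)]
    refine Finset.sum_congr rfl fun c _ => ?_
    have h0 := mk_coeff c ⟨0, by omega⟩
    have h1 := mk_coeff c ⟨1, by omega⟩
    have h2 := mk_coeff c ⟨n - 1, by omega⟩
    have g0 := mk_coeff (c + δ) ⟨0, by omega⟩
    have g1 := mk_coeff (c + δ) ⟨1, by omega⟩
    have g2 := mk_coeff (c + δ) ⟨n - 1, by omega⟩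
    have d0 : δ ⟨0, by omega⟩ = 0 := by
      simp only [δ]; rw [Pi.single_eq_of_ne]; simp; omega
    have d1 : δ ⟨1, by omega⟩ = 0 := by
      simp only [δ]; rw [Pi.single_eq_of_ne]; simp; omega
    have d2 : δ ⟨n - 1, by omega⟩ = - y / a := by
      simp only [δ]; rw [Pi.single_eq_same]
    simp only [Pi.add_apply, d0, d1, d2, add_zero] at g0 g1 g2 h0 h1 h2
    rw [Equiv.coe_addRight, lam, lam]
    rw [nextCoeff_of_natDegree_pos (by rw [mk_natDegree]; omega), mk_natDegree,
      nextCoeff_of_natDegree_pos (by rw [mk_natDegree]; omega), mk_natDegree]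
    simp only [g0, g1, g2, h0, h1, h2]
    split_ifs
    · simp
    · rw [← AddChar.map_add_eq_mul]
      congr 1
      field_simp
      ring
  have : (1 - ψ y) * A ψ a b n = 0 := by linear_combination h
  rcases mul_eq_zero.1 this with h | h
  · exact absurd (by linear_combination -h) hy
  · exact h

open scoped Classical in
noncomputable def Irr (F : Type) [Field F] [Fintype F] [DecidableEq F] (n : ℕ) : Finset F[X] :=
  (Finset.Icc 1 n).biUnion fun m => (Mon F m).filter Irreducible

lemma mem_Irr {n : ℕ} {f : F[X]} : f ∈ Irr F n ↔ f.Monic ∧ Irreducible f ∧ f.natDegree ≤ n := by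
  simp only [Irr, Finset.mem_biUnion, Finset.mem_filter, mem_Mon, Finset.mem_Icc]
  constructor
  · rintro ⟨m, ⟨_, h1⟩, ⟨h2, h3⟩, h4⟩; exact ⟨h2, h4, by omega⟩
  · rintro ⟨h2, h4, h1⟩
    exact ⟨f.natDegree, ⟨h4.natDegree_pos, h1⟩, ⟨h2, rfl⟩, h4⟩

open UniqueFactorizationMonoid in
open scoped Classical in
lemma deg_eq {n : ℕ} {f : F[X]} (hf : f ∈ Mon F n) :
    n = ∑ P ∈ Irr F n, ∑ j ∈ Finset.Icc 1 n, if P ^ j ∣ f then P.natDegree else 0 := by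
  obtain ⟨hm, hd⟩ := mem_Mon.1 hf
  have hf0 := hm.ne_zero
  have hmon : ∀ g ∈ normalizedFactors f, g.Monic := by
    intro g hg
    have := normalize_normalized_factor g hg
    rw [← this]
    exact monic_normalize (irreducible_of_normalized_factor g hg).ne_zero
  have hprod : (normalizedFactors f).prod = f := by
    rw [prod_normalizedFactors_eq hf0, hm.normalize_eq_self]
  have h1 : n = ((normalizedFactors f).map natDegree).sum := by
    rw [← natDegree_multiset_prod_of_monic _ hmon, hprod, hd]
  have hcount : ∀ P ∈ Irr F n, (∑ j ∈ Finset.Icc 1 n, if P ^ j ∣ f then P.natDegree else 0) =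
      (normalizedFactors f).count P * P.natDegree := by
    intro P hP
    obtain ⟨p1, p2, p3⟩ := mem_Irr.1 hP
    have hem := emultiplicity_eq_count_normalizedFactors p2 hf0
    rw [p1.normalize_eq_self] at hem
    have hdvd : ∀ j, P ^ j ∣ f ↔ j ≤ (normalizedFactors f).count P := by
      intro j
      rw [pow_dvd_iff_le_emultiplicity, hem]
      exact_mod_cast Iff.rfl
    have hle : (normalizedFactors f).count P ≤ n := by
      have := natDegree_le_of_dvd ((hdvd _).2 le_rfl) hf0
      rw [natDegree_pow, hd] at this
      exact (Nat.le_mul_of_pos_right _ p2.natDegree_pos).trans this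
    rw [← Finset.sum_filter, Finset.sum_const, smul_eq_mul]
    congr 1
    rw [Finset.filter_congr (q := fun j => j ≤ (normalizedFactors f).count P) (fun j _ => hdvd j)]
    trans (Finset.Icc 1 ((normalizedFactors f).count P)).card
    swap
    · simp
    congr 1
    ext j
    simp only [Finset.mem_filter, Finset.mem_Icc]
    omega
  rw [Finset.sum_congr rfl hcount]
  conv_lhs => rw [h1, Finset.sum_multiset_map_count]
  simp only [smul_eq_mul]
  apply Finset.sum_subset
  · intro P hP
    rw [Multiset.mem_toFinset] at hP
    refine mem_Irr.2 ⟨hmon P hP, irreducible_of_normalized_factor P hP, ?_⟩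
    rw [← hd]
    exact natDegree_le_of_dvd (dvd_of_mem_normalizedFactors hP) hf0
  · intro P _ hP
    rw [Multiset.mem_toFinset] at hP
    simp [Multiset.count_eq_zero.2 hP]

variable (ψ a b)
open scoped Classical in
noncomputable def kap (k : ℕ) : ℂ :=
  ∑ P ∈ (Irr F k).filter (fun P => P.natDegree ∣ k), (P.natDegree : ℂ) * lam ψ a b P ^ (k / P.natDegree)

open scoped Classical in
lemma sum_dvd {n j : ℕ} {P : F[X]} (hP : P.Monic) :
    ∑ f ∈ (Mon F n).filter (fun f => P ^ j ∣ f), lam ψ a b f =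
      if j * P.natDegree ≤ n then lam ψ a b P ^ j * A ψ a b (n - j * P.natDegree) else 0 := by
  have hPj := hP.pow j
  split_ifs with h
  · rw [A, Finset.mul_sum]
    symm
    refine Finset.sum_bij (fun g _ => P ^ j * g) ?_ ?_ ?_ ?_
    · intro g hg
      obtain ⟨g1, g2⟩ := mem_Mon.1 hg
      rw [Finset.mem_filter, mem_Mon]
      refine ⟨⟨hPj.mul g1, ?_⟩, dvd_mul_right _ _⟩
      rw [hPj.natDegree_mul g1, hP.natDegree_pow, g2]; omega
    · intro g _ g' _ hgg
      exact mul_left_cancel₀ hPj.ne_zero hgg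
    · intro f hf
      rw [Finset.mem_filter, mem_Mon] at hf
      obtain ⟨⟨f1, f2⟩, g, rfl⟩ := hf
      have g1 := hPj.of_mul_monic_left f1
      refine ⟨g, ?_, rfl⟩
      rw [mem_Mon]
      refine ⟨g1, ?_⟩
      rw [hPj.natDegree_mul g1, hP.natDegree_pow] at f2; omega
    · intro g hg
      obtain ⟨g1, g2⟩ := mem_Mon.1 hg
      rw [lam_mul _ _ _ hPj g1, lam_pow _ _ _ hP]
  · rw [Finset.filter_eq_empty_iff.2, Finset.sum_empty]
    intro f hf hd
    obtain ⟨f1, f2⟩ := mem_Mon.1 hf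
    have := natDegree_le_of_dvd hd f1.ne_zero
    rw [hP.natDegree_pow] at this
    omega

theorem newton (n : ℕ) : (n : ℂ) * A ψ a b n = ∑ k ∈ Finset.Icc 1 n, kap ψ a b k * A ψ a b (n - k) := by
  classical
  have h1 : (n : ℂ) * A ψ a b n = ∑ P ∈ Irr F n, ∑ j ∈ Finset.Icc 1 n,
      (P.natDegree : ℂ) * (if j * P.natDegree ≤ n then lam ψ a b P ^ j * A ψ a b (n - j * P.natDegree) else 0) := by
    have : ∀ f ∈ Mon F n, (n : ℂ) * lam ψ a b f = ∑ P ∈ Irr F n, ∑ j ∈ Finset.Icc 1 n,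
        if P ^ j ∣ f then (P.natDegree : ℂ) * lam ψ a b f else 0 := by
      intro f hf
      conv_lhs => rw [deg_eq hf]
      push_cast
      rw [Finset.sum_mul]
      refine Finset.sum_congr rfl fun P _ => ?_
      rw [Finset.sum_mul]
      refine Finset.sum_congr rfl fun P _ => ?_
      split_ifs <;> simp
    rw [A, Finset.mul_sum, Finset.sum_congr rfl this, Finset.sum_comm]
    refine Finset.sum_congr rfl fun P hP => ?_
    rw [Finset.sum_comm]
    refine Finset.sum_congr rfl fun j _ => ?_
    rw [← sum_dvd ψ a b (mem_Irr.1 hP).1, ← Finset.sum_filter, Finset.mul_sum]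
  have h2 : ∀ k ∈ Finset.Icc 1 n, kap ψ a b k = ∑ P ∈ Irr F n,
      if P.natDegree ∣ k then (P.natDegree : ℂ) * lam ψ a b P ^ (k / P.natDegree) else 0 := by
    intro k hk
    rw [Finset.mem_Icc] at hk
    rw [kap, ← Finset.sum_filter]
    congr 1
    ext P
    simp only [Finset.mem_filter, mem_Irr]
    constructor
    · rintro ⟨⟨p1, p2, p3⟩, p4⟩; exact ⟨⟨p1, p2, by omega⟩, p4⟩
    · rintro ⟨⟨p1, p2, p3⟩, p4⟩; exact ⟨⟨p1, p2, Nat.le_of_dvd (by omega) p4⟩, p4⟩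
  have h3 : ∑ k ∈ Finset.Icc 1 n, kap ψ a b k * A ψ a b (n - k) = ∑ k ∈ Finset.Icc 1 n, ∑ P ∈ Irr F n,
      (if P.natDegree ∣ k then (P.natDegree : ℂ) * lam ψ a b P ^ (k / P.natDegree) else 0) * A ψ a b (n - k) :=
    Finset.sum_congr rfl fun k hk => by rw [h2 k hk, Finset.sum_mul]
  rw [h1, h3, Finset.sum_comm (s := Finset.Icc 1 n)]
  refine Finset.sum_congr rfl fun P hP => ?_
  have hd : 0 < P.natDegree := (mem_Irr.1 hP).2.1.natDegree_pos
  set d := P.natDegree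
  simp only [mul_ite, mul_zero, ite_mul, zero_mul]
  rw [← Finset.sum_filter, ← Finset.sum_filter]
  refine Finset.sum_bij (fun j _ => j * d) ?_ ?_ ?_ ?_
  · intro j hj
    simp only [Finset.mem_filter, Finset.mem_Icc] at hj ⊢
    exact ⟨⟨Nat.mul_pos (by omega) hd, hj.2⟩, Dvd.intro_left j rfl⟩
  · intro j _ j' _ h
    exact Nat.eq_of_mul_eq_mul_right hd h
  · intro k hk
    simp only [Finset.mem_filter, Finset.mem_Icc] at hk
    obtain ⟨⟨k1, k2⟩, j, rfl⟩ := hk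
    refine ⟨j, ?_, mul_comm _ _⟩
    simp only [Finset.mem_filter, Finset.mem_Icc]
    refine ⟨⟨Nat.pos_of_ne_zero ?_, ?_⟩, by rwa [mul_comm]⟩
    · rintro rfl; simp at k1
    · exact (Nat.le_mul_of_pos_left _ hd).trans k2
  · intro j _
    rw [Nat.mul_div_cancel _ hd]; ring

section rec
variable {ψ a b}
lemma kap_one : kap ψ a b 1 = A ψ a b 1 := by
  have := newton ψ a b 1
  simp [A_zero] at this
  exact this.symm

lemma kap_two (hψ : ψ.IsPrimitive) (ha : a ≠ 0) (hb : b ≠ 0) :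
    kap ψ a b 2 = 2 * Fintype.card F - A ψ a b 1 ^ 2 := by
  have := newton ψ a b 2
  simp only [Finset.sum_Icc_succ_top (show 1 ≤ 1 + 1 by norm_num), Finset.Icc_self, Finset.sum_singleton] at this
  norm_num [A_zero, A_two hψ ha hb, kap_one] at this
  linear_combination -this

lemma kap_rec (hψ : ψ.IsPrimitive) (ha : a ≠ 0) (hb : b ≠ 0) (n : ℕ) :
    kap ψ a b (n + 3) = - A ψ a b 1 * kap ψ a b (n + 2) - Fintype.card F * kap ψ a b (n + 1) := by
  have := newton ψ a b (n + 3)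
  rw [A_big hψ ha (by omega), Finset.sum_Icc_succ_top (by omega), Finset.sum_Icc_succ_top (by omega),
    Finset.sum_Icc_succ_top (by omega), Finset.sum_eq_zero] at this
  · rw [show n + 3 - (n + 1) = 2 by omega, show n + 3 - (n + 1 + 1) = 1 by omega,
      show n + 3 - (n + 2 + 1) = 0 by omega, A_zero, A_two hψ ha hb] at this
    linear_combination -this
  · intro k hk
    rw [Finset.mem_Icc] at hk
    rw [A_big hψ ha (by omega), mul_zero]

lemma kap_closed (hψ : ψ.IsPrimitive) (ha : a ≠ 0) (hb : b ≠ 0) (α β : ℂ)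
    (h1 : α + β = - A ψ a b 1) (h2 : α * β = Fintype.card F) (n : ℕ) :
    kap ψ a b (n + 1) = - (α ^ (n + 1) + β ^ (n + 1)) := by
  induction n using Nat.strong_induction_on with
  | _ n ih =>
    match n with
    | 0 => simp [kap_one, h1]
    | 1 => rw [kap_two hψ ha hb, ← h2]; linear_combination (α + β - A ψ a b 1) * h1
    | n + 2 =>
      have i1 := ih n (by omega)
      have i2 := ih (n + 1) (by omega)
      rw [kap_rec hψ ha hb, i1, i2, ← h2, ← h1]
      ring
end rec

section field
variable {E : Type} [Field E] [Fintype E] [DecidableEq E] [Algebra F E]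

lemma minpoly_inv [FiniteDimensional F E] (x : E) (hx : x ≠ 0) :
    (minpoly F x⁻¹).nextCoeff = (minpoly F x).coeff 1 / (minpoly F x).coeff 0 ∧
    (minpoly F x⁻¹).natDegree = (minpoly F x).natDegree := by
  have hroot : ∀ y : E, y ≠ 0 → aeval y⁻¹ (minpoly F y).reverse = 0 := by
    intro y hy
    let _ : Invertible y := invertibleOfNonzero hy
    have := (eval₂_reverse_eq_zero_iff (algebraMap F E) y (minpoly F y)).2 (minpoly.aeval F y)
    rwa [invOf_eq_inv] at this
  have hintg : ∀ y : E, IsIntegral F y := fun y => .of_finite F y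
  have hc0 := minpoly.coeff_zero_ne_zero (hintg x) hx
  have hle : ∀ y : E, y ≠ 0 → (minpoly F y⁻¹).natDegree ≤ (minpoly F y).natDegree := by
    intro y hy
    refine (natDegree_le_of_dvd (minpoly.dvd F _ (hroot y hy)) ?_).trans (reverse_natDegree_le _)
    rw [Ne, reverse_eq_zero]
    exact minpoly.ne_zero (hintg y)
  have hdeg : (minpoly F x⁻¹).natDegree = (minpoly F x).natDegree := by
    refine le_antisymm (hle x hx) ?_
    simpa using hle x⁻¹ (inv_ne_zero hx)
  refine ⟨?_, hdeg⟩
  set P := minpoly F x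
  have htr : P.natTrailingDegree = 0 := natTrailingDegree_eq_zero.2 (Or.inr hc0)
  have hlead : P.reverse.leadingCoeff = P.coeff 0 := by
    rw [reverse_leadingCoeff, trailingCoeff, htr]
  have hmon : (P.reverse * C (P.coeff 0)⁻¹).Monic := by
    rw [Monic, leadingCoeff_mul, hlead, leadingCoeff_C, mul_inv_cancel₀ hc0]
  have heq : P.reverse * C (P.coeff 0)⁻¹ = minpoly F x⁻¹ := by
    refine minpoly.unique_of_degree_le_degree_minpoly F _ hmon ?_ ?_
    · rw [map_mul, hroot x hx, zero_mul]
    · rw [degree_eq_natDegree hmon.ne_zero, degree_eq_natDegree (minpoly.ne_zero (hintg _)), hdeg]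
      refine Nat.cast_le.2 ((natDegree_mul_C_le _ _).trans (reverse_natDegree_le _))
  rw [← heq, nextCoeff_mul_C, ← coeff_one_reverse, div_eq_mul_inv]
  congr 1
  rw [coeff_reverse, reverse_natDegree, htr]
  by_cases h1 : P.natDegree = 0
  · exact absurd h1 (minpoly.natDegree_pos (hintg x)).ne'
  rw [Nat.sub_zero, coeff_reverse, revAt_invol]

lemma trace_eq (x : E) : Algebra.trace F E x =
    ((Module.finrank F E / (minpoly F x).natDegree : ℕ) : F) * -(minpoly F x).nextCoeff := by
  rw [trace_eq_finrank_mul_minpoly_nextCoeff]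
  congr 2
  rw [← IntermediateField.adjoin.finrank (.of_finite F x),
    ← Module.finrank_mul_finrank F (IntermediateField.adjoin F {x}) E, Nat.mul_div_cancel_left]
  exact Module.finrank_pos

lemma card_minpoly (P : F[X]) (hm : P.Monic) (hi : Irreducible P) (hd : P.natDegree ∣ Module.finrank F E) :
    Nat.card {x : E // minpoly F x = P} = P.natDegree := by
  have : Fact (Irreducible P) := ⟨hi⟩
  have hspl : (P.map (algebraMap F E)).Splits := by
    have hdvd := (hi.natDegree_dvd_iff_dvd_X_pow_card_pow_sub_X).1 hd
    have hcard : Nat.card F ^ Module.finrank F E = Nat.card E :=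
      (Module.natCard_eq_pow_finrank (K := F) (V := E)).symm
    rw [hcard] at hdvd
    have h1 : (X ^ Nat.card E - X : E[X]).Splits := by
      rw [Nat.card_eq_fintype_card, splits_iff_card_roots, FiniteField.roots_X_pow_card_sub_X,
        FiniteField.X_pow_card_sub_X_natDegree_eq E Fintype.one_lt_card]
      rfl
    refine Splits.of_dvd h1 ?_ ?_
    · exact FiniteField.X_pow_card_sub_X_ne_zero E Finite.one_lt_card
    · simpa using map_dvd (algebraMap F E) hdvd
  have hsep : P.Separable := PerfectField.separable_of_irreducible hi
  have := card_rootSet_eq_natDegree hsep hspl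
  rw [← this, ← Nat.card_eq_fintype_card]
  refine Nat.card_congr (Equiv.subtypeEquivRight fun x => ?_)
  rw [mem_rootSet, eq_comm, minpoly.eq_iff_aeval_eq_zero hi hm]
  simp [hm.ne_zero]

lemma lam_minpoly (x : E) : lam ψ a b (minpoly F x) ^ (Module.finrank F E / (minpoly F x).natDegree) =
    if x = 0 then 0 else ψ (a * Algebra.trace F E x + b * Algebra.trace F E x⁻¹) := by
  by_cases hx : x = 0
  · subst hx
    rw [minpoly.zero, if_pos rfl, lam, if_pos (by simp)]
    simp [Module.finrank_pos.ne']
  have hintg : IsIntegral F x := .of_finite F x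
  rw [lam, if_neg (minpoly.coeff_zero_ne_zero hintg hx), if_neg hx, ← AddChar.map_nsmul_eq_pow]
  obtain ⟨h1, h2⟩ := minpoly_inv (F := F) x hx
  rw [trace_eq x, trace_eq x⁻¹, h1, h2, nsmul_eq_mul]
  congr 1
  ring

theorem kap_field {n : ℕ} (hn : Module.finrank F E = n) : kap ψ a b n =
    ∑ x : E, if x = 0 then 0 else ψ (a * Algebra.trace F E x + b * Algebra.trace F E x⁻¹) := by
  classical
  rw [kap, ← Finset.sum_fiberwise_of_maps_to (s := Finset.univ) (g := fun x : E => minpoly F x)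
    (t := (Irr F n).filter (fun P => P.natDegree ∣ n))]
  · refine Finset.sum_congr rfl fun P hP => ?_
    rw [Finset.mem_filter, mem_Irr] at hP
    have hc : ∀ x ∈ Finset.univ.filter (fun x : E => minpoly F x = P), (if x = 0 then (0:ℂ) else
        ψ (a * Algebra.trace F E x + b * Algebra.trace F E x⁻¹)) = lam ψ a b P ^ (n / P.natDegree) := by
      intro x hx
      rw [Finset.mem_filter] at hx
      rw [← lam_minpoly, hx.2, hn]
    rw [Finset.sum_congr rfl hc, Finset.sum_const, nsmul_eq_mul]
    congr 2
    rw [← card_minpoly (E := E) P hP.1.1 hP.1.2.1 (by rw [hn]; exact hP.2), Nat.card_eq_fintype_card,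
      Fintype.card_subtype]
  · intro x _
    have hintg : IsIntegral F x := .of_finite F x
    have hd : (minpoly F x).natDegree ∣ n := by
      rw [← hn]; exact minpoly.degree_dvd hintg
    rw [Finset.mem_filter, mem_Irr]
    exact ⟨⟨minpoly.monic hintg, minpoly.irreducible hintg, Nat.le_of_dvd (by rw [← hn]; exact Module.finrank_pos) hd⟩, hd⟩
end field
end LF


namespace KL
open Polynomial
variable {F : Type} [Field F] [Fintype F] [DecidableEq F]
variable {E : Type} [Field E] [Fintype E] [DecidableEq E] [Algebra F E]

lemma fix_iff (y : E) : y ^ Fintype.card F = y ↔ ∃ c : F, algebraMap F E c = y := by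
  constructor
  · intro hy
    have h1 : 1 < Fintype.card F := Fintype.one_lt_card
    have hne := FiniteField.X_pow_card_sub_X_ne_zero E h1
    have hsub : (Finset.univ.image (algebraMap F E)) ⊆ (X ^ Fintype.card F - X : E[X]).roots.toFinset := by
      intro z hz
      obtain ⟨c, -, rfl⟩ := Finset.mem_image.1 hz
      rw [Multiset.mem_toFinset, mem_roots hne, IsRoot.def]
      simp [← map_pow, FiniteField.pow_card]
    have hcard : (X ^ Fintype.card F - X : E[X]).roots.toFinset.card ≤ (Finset.univ.image (algebraMap F E)).card := by
      rw [Finset.card_image_of_injective _ (algebraMap F E).injective, Finset.card_univ]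
      refine (Multiset.toFinset_card_le _).trans ((card_roots' _).trans ?_)
      rw [FiniteField.X_pow_card_sub_X_natDegree_eq E h1]
    have heq := Finset.eq_of_subset_of_card_le hsub hcard
    have : y ∈ (X ^ Fintype.card F - X : E[X]).roots.toFinset := by
      rw [Multiset.mem_toFinset, mem_roots hne, IsRoot.def]
      simp [hy]
    rw [← heq] at this
    obtain ⟨c, -, h⟩ := Finset.mem_image.1 this
    exact ⟨c, h⟩
  · rintro ⟨c, rfl⟩
    rw [← map_pow, FiniteField.pow_card]

noncomputable def L (F E : Type) [Field F] [Fintype F] [Field E] [Fintype E] [Algebra F E] : E →ₗ[F] E :=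
  (FiniteField.frobeniusAlgHom F E).toLinearMap - LinearMap.id

lemma L_apply (y : E) : L F E y = y ^ Fintype.card F - y := by
  simp [L, FiniteField.frobeniusAlgHom_apply]

lemma trace_frob (y : E) : Algebra.trace F E (y ^ Fintype.card F) = Algebra.trace F E y := by
  have := Algebra.trace_eq_of_algEquiv (FiniteField.frobeniusAlgEquivOfAlgebraic F E) y
  simpa using this

lemma range_L : LinearMap.range (L F E) = LinearMap.ker (Algebra.trace F E) := by
  apply Submodule.eq_of_le_of_finrank_le
  · rintro _ ⟨y, rfl⟩
    rw [LinearMap.mem_ker, L_apply, map_sub, trace_frob, sub_self]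
  · have h1 := LinearMap.finrank_range_add_finrank_ker (L F E)
    have h2 := LinearMap.finrank_range_add_finrank_ker (Algebra.trace F E)
    rw [LinearMap.range_eq_top.2 (Algebra.trace_surjective F E), finrank_top, Module.finrank_self] at h2
    have h3 : Module.finrank F (LinearMap.ker (L F E)) ≤ 1 := by
      refine (Submodule.finrank_mono (t := Submodule.span F {(1 : E)}) ?_).trans ?_
      · intro y hy
        rw [LinearMap.mem_ker, L_apply, sub_eq_zero, fix_iff] at hy
        obtain ⟨c, rfl⟩ := hy
        rw [Submodule.mem_span_singleton]
        exact ⟨c, by rw [Algebra.smul_def, mul_one]⟩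
      · exact (finrank_span_le_card _).trans (by simp)
    omega

lemma card_fib (z : E) : (Finset.univ.filter fun y : E => y ^ Fintype.card F - y = z).card =
    if Algebra.trace F E z = 0 then Fintype.card F else 0 := by
  split_ifs with h
  · have hz : z ∈ Set.range (L F E) := by
      have : z ∈ LinearMap.range (L F E) := by rw [range_L]; exact h
      exact this
    have h0 : (0 : E) ∈ Set.range (L F E) := ⟨0, map_zero _⟩
    have := AddMonoidHom.card_fiber_eq_of_mem_range (L F E) hz h0
    simp only [L_apply] at this
    have hc : (Finset.univ.image (algebraMap F E)).card = Fintype.card F := by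
      rw [Finset.card_image_of_injective _ (algebraMap F E).injective, Finset.card_univ]
    refine this.trans (Eq.trans ?_ hc)
    congr 1
    ext y
    simp [sub_eq_zero, fix_iff]
  · rw [Finset.card_eq_zero, Finset.filter_eq_empty_iff]
    rintro y - rfl
    rw [map_sub, trace_frob, sub_self] at h
    exact h rfl

lemma card_fib_char {ψ : AddChar F ℂ} (hψ : ψ.IsPrimitive) (z : E) :
    (((Finset.univ.filter fun y : E => y ^ Fintype.card F - y = z).card : ℕ) : ℂ) =
    ∑ c : F, ψ (c * Algebra.trace F E z) := by
  rw [card_fib, AddChar.sum_mulShift _ hψ]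

noncomputable def S (F : Type) {E : Type} [Field F] [Fintype F] [DecidableEq F] [Field E] [Fintype E] [DecidableEq E]
    (a b : E) : ℕ :=
  (Finset.univ.filter fun v : E × E => v.1 ≠ 0 ∧ v.2 ^ Fintype.card F - v.2 = a * v.1 + b * v.1⁻¹).card

lemma S_eq {ψ : AddChar F ℂ} (hψ : ψ.IsPrimitive) (a b : F) {n : ℕ} (hn : Module.finrank F E = n) :
    (S F (algebraMap F E a) (algebraMap F E b) : ℂ) =
    (Fintype.card E : ℂ) - 1 + ∑ c ∈ Finset.univ.erase (0 : F), LF.kap ψ (c * a) (c * b) n := by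
  have h1 : (S F (algebraMap F E a) (algebraMap F E b) : ℂ) =
      ∑ x : E, if x = 0 then 0 else ∑ c : F, ψ (c * Algebra.trace F E (algebraMap F E a * x + algebraMap F E b * x⁻¹)) := by
    rw [S, Finset.card_filter, Fintype.sum_prod_type, Nat.cast_sum]
    refine Finset.sum_congr rfl fun x _ => ?_
    by_cases hx : x = 0
    · simp [hx]
    · rw [if_neg hx, ← card_fib_char hψ, Finset.card_filter]
      simp [hx]
  rw [h1]
  have h2 : ∀ x : E, (if x = 0 then (0 : ℂ) else ∑ c : F, ψ (c * Algebra.trace F E (algebraMap F E a * x + algebraMap F E b * x⁻¹))) =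
      ∑ c : F, if x = 0 then 0 else ψ (c * a * Algebra.trace F E x + c * b * Algebra.trace F E x⁻¹) := by
    intro x
    split_ifs
    · simp
    · refine Finset.sum_congr rfl fun c _ => ?_
      rw [map_add, ← Algebra.smul_def, ← Algebra.smul_def, map_smul, map_smul, smul_eq_mul, smul_eq_mul]
      congr 1; ring
  simp only [h2]
  rw [Finset.sum_comm, ← Finset.add_sum_erase _ _ (Finset.mem_univ (0 : F))]
  congr 1
  · simp only [zero_mul, zero_add, AddChar.map_zero_eq_one]
    rw [← Finset.add_sum_erase _ _ (Finset.mem_univ (0 : E)), if_pos rfl, zero_add]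
    rw [Finset.sum_congr rfl (g := fun _ => (1 : ℂ)) (fun x hx => if_neg (Finset.ne_of_mem_erase hx))]
    rw [Finset.sum_const, Finset.card_erase_of_mem (Finset.mem_univ _), Finset.card_univ, nsmul_eq_mul, mul_one,
      Nat.cast_sub Fintype.card_pos]
    simp
  · exact Finset.sum_congr rfl fun c _ => (LF.kap_field ψ _ _ hn).symm

lemma two_counts (h2 : ringChar E ≠ 2) {ε : E} (hε : quadraticChar E ε = -1) (D : E → E) :
    (Finset.univ.filter fun v : E × E => v.2 ^ 2 = D v.1).card +
    (Finset.univ.filter fun v : E × E => v.2 ^ 2 = ε * D v.1).card = 2 * Fintype.card E := by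
  rw [Finset.card_filter, Finset.card_filter, Fintype.sum_prod_type, Fintype.sum_prod_type, ← Finset.sum_add_distrib]
  have : ∀ x : E, ((∑ y : E, if y ^ 2 = D x then 1 else 0) + ∑ y : E, if y ^ 2 = ε * D x then 1 else 0) = 2 := by
    intro x
    have h1 := quadraticChar_card_sqrts h2 (D x)
    have h3 := quadraticChar_card_sqrts h2 (ε * D x)
    rw [map_mul, hε] at h3
    have e : ∀ z : E, (∑ y : E, if y ^ 2 = z then 1 else 0) = ({y : E | y ^ 2 = z}.toFinset).card := by
      intro z
      rw [← Finset.card_filter]; congr 1; ext; simp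
    rw [e, e]
    zify
    rw [h1, h3]; ring
  simp only [this]
  simp [mul_comm]

lemma S_lower (p : ℕ) [hp : Fact p.Prime] [CharP E p] (k ρ : ℕ)
    (hr : p ^ k = 2 * ρ + 1) (hQ : Fintype.card E = (2 * ρ + 1) ^ 2) (h2 : (2 : E) ≠ 0)
    (hρ : Fintype.card F - 1 + (Fintype.card F) ^ 2 ≤ 4 * ρ) {a b β y1 : E} (ha : a ≠ 0) (hb : b ≠ 0)
    (hβ : β ^ 2 = a * b) (hy1 : y1 ^ Fintype.card F - y1 = 2 * β) :
    2 * Fintype.card E ≤ S F a b + 1 + (Fintype.card E + 2 * Fintype.card F * (2 * ρ + 1)) := by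
  have hadd : ∀ x y : E, (x + y) ^ Fintype.card F = x ^ Fintype.card F + y ^ Fintype.card F := by
    intro x y
    have := map_add (FiniteField.frobeniusAlgHom F E) x y
    simpa using this
  have hq1 : 1 < Fintype.card F := Fintype.one_lt_card
  obtain ⟨m, hm⟩ : ∃ m, Fintype.card F = m + 2 := ⟨Fintype.card F - 2, by omega⟩
  have hβ0 : β ≠ 0 := by
    rintro rfl
    have : a * b = 0 := by rw [← hβ]; ring
    exact (mul_ne_zero ha hb) this
  have h4 : (4 : E) ≠ 0 := by
    have : (4 : E) = 2 * 2 := by norm_num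
    rw [this]; exact mul_ne_zero h2 h2
  have hchar : ringChar E ≠ 2 := by
    intro h
    apply h2
    have := ringChar.Nat.cast_ringChar (R := E)
    rw [h] at this
    exact_mod_cast this
  obtain ⟨ε, hε⟩ := quadraticChar_exists_neg_one hchar
  have hε0 : ε ≠ 0 := by
    rintro rfl
    simp at hε
  let D : E → E := fun y => (y ^ Fintype.card F - y) * (y ^ Fintype.card F - y + 4 * β)
  have hc := two_counts hchar hε D
  have hA : (Finset.univ.filter fun v : E × E => v.2 ^ 2 = D v.1).card ≤ S F a b := by
    rw [S]
    refine Finset.card_le_card_of_injOn (fun v => ((v.2 + (v.1 ^ Fintype.card F - v.1 + 2 * β)) / (2 * a), v.1 + y1)) ?_ ?_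
    · rintro ⟨y, w⟩ hv
      simp only [Finset.coe_filter, Finset.mem_univ, true_and, Set.mem_ofPred_eq, D] at hv ⊢
      set z := y ^ Fintype.card F - y with hz
      have key : a * ((w + (z + 2 * β)) / (2 * a)) ^ 2 - (z + 2 * β) * ((w + (z + 2 * β)) / (2 * a)) + b = 0 := by
        have : a * ((w + (z + 2 * β)) / (2 * a)) ^ 2 - (z + 2 * β) * ((w + (z + 2 * β)) / (2 * a)) + b
          = (w ^ 2 - (z + 2 * β) ^ 2 + 4 * (a * b)) / (4 * a) := by
          field_simp; ring
        rw [this, hv, ← hβ]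
        ring
      set x := (w + (z + 2 * β)) / (2 * a)
      have hx : x ≠ 0 := by
        intro h
        rw [h] at key
        apply hb
        linear_combination key
      refine ⟨hx, ?_⟩
      rw [hadd]
      have : y ^ Fintype.card F + y1 ^ Fintype.card F - (y + y1) = z + 2 * β := by
        rw [hz]; linear_combination hy1
      rw [this]
      field_simp
      linear_combination -key
    · rintro ⟨y, w⟩ - ⟨y', w'⟩ - h
      simp only [Prod.mk.injEq] at h
      obtain ⟨h1, h3⟩ := h
      have h3 := add_right_cancel h3
      subst h3
      rw [div_left_inj' (mul_ne_zero h2 ha)] at h1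
      rw [add_right_cancel h1]
  let h : E[X] := C ε * ((1 - X ^ (m + 1)) * (1 - X ^ (m + 1) + C (4 * β) * X ^ (m + 2)))
  have hd1 : (1 - X ^ (m + 1) : E[X]).natDegree = m + 1 := by
    compute_degree!
  have hd2 : (1 - X ^ (m + 1) + C (4 * β) * X ^ (m + 2) : E[X]).natDegree = m + 2 := by
    compute_degree!
  have hdeg : h.natDegree = 2 * (m + 1) + 1 := by
    rw [natDegree_C_mul hε0, natDegree_mul, hd1, hd2]
    · ring
    · intro h; rw [h] at hd1; simp at hd1
    · intro h; rw [h] at hd2; simp at hd2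
  have hB := Bomb.bombieri p k ρ (m + 1) hr hQ h hdeg h2 (by rw [hm] at hρ; exact hρ) (by rw [hm] at hρ; nlinarith)
  have hC : (Finset.univ.filter fun v : E × E => v.2 ^ 2 = ε * D v.1).card ≤
      1 + (Finset.univ.filter fun v : E × E => v.2 ^ 2 = h.eval v.1).card := by
    have : (Finset.univ.filter fun v : E × E => v.2 ^ 2 = ε * D v.1) ⊆ {(0, 0)} ∪
      ((Finset.univ.filter fun v : E × E => v.2 ^ 2 = h.eval v.1).image
        fun v => (v.1⁻¹, v.2 * (v.1⁻¹) ^ (m + 2))) := by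
      rintro ⟨y, w⟩ hv
      simp only [Finset.mem_filter, Finset.mem_univ, true_and, D] at hv
      by_cases hy : y = 0
      · subst hy
        rw [hm] at hv
        simp at hv
        simp [hv]
      · rw [Finset.mem_union, Finset.mem_image]
        right
        refine ⟨(y⁻¹, w * y⁻¹ ^ (m + 2)), ?_, ?_⟩
        · simp only [Finset.mem_filter, Finset.mem_univ, true_and, h]
          rw [mul_pow, hv, hm]
          simp only [eval_mul, eval_C, eval_sub, eval_add, eval_one, eval_pow, eval_X, inv_pow]
          field_simp
          ring
        · simp only [inv_inv, Prod.mk.injEq, true_and, inv_pow]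
          field_simp
    refine (Finset.card_le_card this).trans ((Finset.card_union_le _ _).trans ?_)
    exact Nat.add_le_add (by simp) Finset.card_image_le
  rw [← hQ] at hB
  rw [hm]
  have : (2 * (m + 1) + 2) = 2 * (m + 2) := by ring
  rw [this] at hB
  omega



lemma trace_zero {E : Type} [Field E] [Fintype E] [DecidableEq E] [Algebra F E]
    (p : ℕ) [CharP E p] (N : ℕ) (hp : p ∣ N) (hn : Module.finrank F E = 2 * N) (hodd : Odd (Fintype.card F))
    (c : F) (β : E) (hβ : β ^ 2 = algebraMap F E c) : Algebra.trace F E β = 0 := by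
  have h1 : (β ^ Fintype.card F) ^ 2 = β ^ 2 := by
    rw [← pow_mul, mul_comm, pow_mul, hβ, ← map_pow, FiniteField.pow_card]
  have h2 : β ^ (Fintype.card F ^ 2) = β := by
    rcases sq_eq_sq_iff_eq_or_eq_neg.1 h1 with h | h
    · rw [pow_two, pow_mul, h, h]
    · rw [pow_two, pow_mul, h, hodd.neg_pow, h, neg_neg]
  have h3 : ∀ j, β ^ (Fintype.card F ^ (2 * j)) = β := by
    intro j
    induction j with
    | zero => simp
    | succ j ih => rw [mul_add, pow_add, pow_mul, ih, mul_one, h2]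
  have h4 : ∀ j, ∑ i ∈ Finset.range (2 * j), β ^ (Fintype.card F ^ i) = j * (β + β ^ Fintype.card F) := by
    intro j
    induction j with
    | zero => simp
    | succ j ih =>
      rw [mul_add, mul_one, Finset.sum_range_succ, Finset.sum_range_succ, ih, h3, pow_succ (Fintype.card F), pow_mul, h3]
      push_cast; ring
  have h5 := FiniteField.algebraMap_trace_eq_sum_pow F E β
  rw [hn, Nat.card_eq_fintype_card, h4, (CharP.cast_eq_zero_iff E p N).2 hp, zero_mul] at h5
  exact (map_eq_zero _).1 h5

lemma main_ineq (p : ℕ) [hp : Fact p.Prime] [CharP F p] (hodd : Odd (Fintype.card F))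
    {ψ : AddChar F ℂ} (hψ : ψ.IsPrimitive) {a b : F} (ha : a ≠ 0) (hb : b ≠ 0) (m : ℕ) (hm : 1 ≤ m) :
    (- ∑ c ∈ Finset.univ.erase (0 : F), LF.kap ψ (c * a) (c * b) (2 * (p * m))).re ≤
      2 * Fintype.card F * (Fintype.card F : ℝ) ^ (p * m) := by
  obtain ⟨j, -, hj⟩ := FiniteField.card F p
  set N := p * m with hN
  have hp3 : 3 ≤ p := by
    have h2 := hp.out.two_le
    rcases h2.eq_or_lt with h | h
    · rw [hj, ← h] at hodd
      exact absurd hodd (by rw [Nat.not_odd_iff_even]; exact (even_two).pow_of_ne_zero j.ne_zero)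
    · exact h
  have hN3 : 3 ≤ N := by nlinarith
  have : NeZero (2 * N) := ⟨by omega⟩
  let E := FiniteField.Extension F p (2 * N)
  have : Fintype E := Fintype.ofFinite E
  have : DecidableEq E := Classical.decEq E
  have : CharP E p := charP_of_injective_algebraMap (algebraMap F E).injective p
  have hfr : Module.finrank F E = 2 * N := FiniteField.finrank_extension F p (2 * N)
  have hcE : Fintype.card E = (Fintype.card F ^ N) ^ 2 := by
    have := FiniteField.natCard_extension F p (2 * N)
    rw [Nat.card_eq_fintype_card, Nat.card_eq_fintype_card] at this
    rw [← pow_mul, mul_comm N 2]; exact this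
  obtain ⟨ρ, hρ⟩ : ∃ ρ, Fintype.card F ^ N = 2 * ρ + 1 := hodd.pow
  have hE2 : (2 : E) ≠ 0 := by
    intro h
    have h' : ((2 : ℕ) : E) = 0 := by exact_mod_cast h
    rw [CharP.cast_eq_zero_iff E p] at h'
    have := Nat.le_of_dvd (by norm_num) h'
    omega
  have hchar : ringChar E ≠ 2 := by
    rw [ringChar.eq E p]; omega
  have hq3 : 3 ≤ Fintype.card F := by
    rw [hj]; exact hp3.trans (Nat.le_self_pow j.ne_zero p)
  have hab : a * b ≠ 0 := mul_ne_zero ha hb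
  obtain ⟨β, hβ⟩ : IsSquare (algebraMap F E (a * b)) := by
    rw [FiniteField.isSquare_iff hchar (by rwa [Ne, map_eq_zero])]
    have h1 : Fintype.card E / 2 = 2 * ρ * (ρ + 1) := by
      rw [hcE, hρ]
      have : (2 * ρ + 1) ^ 2 = 2 * (2 * ρ * (ρ + 1)) + 1 := by ring
      rw [this]; omega
    have h2 : Fintype.card F - 1 ∣ 2 * ρ := by
      have := Nat.sub_dvd_pow_sub_pow (Fintype.card F) 1 N
      rw [hρ, one_pow] at this
      simpa using this
    obtain ⟨s, hs⟩ := h2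
    rw [h1, hs, mul_assoc, pow_mul, ← map_pow, FiniteField.pow_card_sub_one_eq_one _ hab, map_one, one_pow]
  have hβ' : β ^ 2 = algebraMap F E (a * b) := by rw [hβ, pow_two]
  have htr := trace_zero p N ⟨m, rfl⟩ hfr hodd _ β hβ'
  obtain ⟨y1, hy1⟩ : (2 * β) ∈ LinearMap.range (L F E) := by
    rw [range_L, LinearMap.mem_ker, two_mul β, map_add, htr, add_zero]
  rw [L_apply] at hy1
  have hlow := S_lower (F := F) p (j * N) ρ (by rw [pow_mul, ← hj, hρ]) (by rw [hcE, hρ]) hE2 (by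
    have : Fintype.card F ^ 3 ≤ Fintype.card F ^ N := Nat.pow_le_pow_right (by omega) hN3
    have h4 : Fintype.card F - 1 ≤ Fintype.card F := Nat.sub_le _ _
    nlinarith [Nat.pow_le_pow_left hq3 2]) (a := algebraMap F E a) (b := algebraMap F E b)
    (by rwa [Ne, map_eq_zero]) (by rwa [Ne, map_eq_zero]) (by rw [hβ', map_mul]) hy1
  have hS := S_eq (E := E) hψ a b hfr
  have h6 := congrArg Complex.re hS
  simp only [Complex.natCast_re, Complex.add_re, Complex.sub_re, Complex.one_re] at h6
  rw [Complex.neg_re]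
  have h7 : (2 * Fintype.card E : ℝ) ≤ (S F (algebraMap F E a) (algebraMap F E b) : ℝ) + 1 + (Fintype.card E + 2 * Fintype.card F * (2 * ρ + 1)) := by
    exact_mod_cast hlow
  have h8 : (Fintype.card F : ℝ) ^ N = 2 * ρ + 1 := by exact_mod_cast hρ
  rw [h8]
  linarith

lemma root_ex (k : ℝ) (q : ℕ) : ∃ α β : ℂ, α + β = - (k : ℂ) ∧ α * β = q ∧
    (∀ N : ℕ, -2 * (q : ℝ) ^ N ≤ (α ^ (2 * N) + β ^ (2 * N)).re) ∧
    (4 * (q : ℝ) < k ^ 2 → ∃ θ : ℝ, (q : ℝ) < θ ∧ ∀ N : ℕ, θ ^ N ≤ (α ^ (2 * N) + β ^ (2 * N)).re) := by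
  by_cases h : 4 * (q : ℝ) < k ^ 2
  · set s := Real.sqrt (k ^ 2 - 4 * q) with hs
    have hs2 : s ^ 2 = k ^ 2 - 4 * q := Real.sq_sqrt (by linarith)
    set α : ℝ := (-k + s) / 2 with hα
    set β : ℝ := (-k - s) / 2 with hβ
    have hre : ∀ N : ℕ, (((α : ℂ) ^ (2 * N) + (β : ℂ) ^ (2 * N))).re = (α ^ 2) ^ N + (β ^ 2) ^ N := by
      intro N
      rw [← Complex.ofReal_pow, ← Complex.ofReal_pow, ← Complex.ofReal_add, Complex.ofReal_re, pow_mul, pow_mul]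
    refine ⟨α, β, ?_, ?_, ?_, ?_⟩
    · rw [← Complex.ofReal_add, ← Complex.ofReal_neg]; congr 1; rw [hα, hβ]; ring
    · rw [← Complex.ofReal_mul, ← Complex.ofReal_natCast]; congr 1; rw [hα, hβ]; nlinarith
    · intro N
      rw [hre]
      have : 0 ≤ (q : ℝ) ^ N := by positivity
      have : 0 ≤ (α ^ 2) ^ N := by positivity
      have : 0 ≤ (β ^ 2) ^ N := by positivity
      linarith
    · intro _
      have hsum : α ^ 2 + β ^ 2 = k ^ 2 - 2 * q := by rw [hα, hβ]; nlinarith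
      by_cases h1 : (q : ℝ) < α ^ 2
      · refine ⟨α ^ 2, h1, fun N => ?_⟩
        rw [hre]
        have : 0 ≤ (β ^ 2) ^ N := by positivity
        linarith
      · refine ⟨β ^ 2, by linarith, fun N => ?_⟩
        rw [hre]
        have : 0 ≤ (α ^ 2) ^ N := by positivity
        linarith
  · set s := Real.sqrt (4 * q - k ^ 2) with hs
    have hs2 : s ^ 2 = 4 * q - k ^ 2 := Real.sq_sqrt (by linarith)
    have hs2' : (s : ℂ) ^ 2 = 4 * q - k ^ 2 := by exact_mod_cast congrArg Complex.ofReal hs2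
    have hI := Complex.I_sq
    have hnorm : ∀ (z : ℂ) (N : ℕ), z.re = -k / 2 → z.im ^ 2 = s ^ 2 / 4 → - (q : ℝ) ^ N ≤ (z ^ (2 * N)).re := by
      intro z N h1 h2
      have h3 : ‖z‖ ^ 2 = q := by
        rw [Complex.sq_norm, Complex.normSq_apply, h1]; nlinarith
      have h4 := Complex.abs_re_le_norm (z ^ (2 * N))
      rw [norm_pow, pow_mul ‖z‖, h3] at h4
      exact (abs_le.1 h4).1
    refine ⟨(⟨-k / 2, s / 2⟩ : ℂ), (⟨-k / 2, -s / 2⟩ : ℂ), ?_, ?_, ?_, fun h' => absurd h' h⟩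
    · apply Complex.ext <;> simp <;> ring
    · apply Complex.ext <;> simp <;> nlinarith
    · intro N
      have h1 := hnorm ⟨-k / 2, s / 2⟩ N rfl (by simp; ring)
      have h2 := hnorm ⟨-k / 2, -s / 2⟩ N rfl (by simp; ring)
      rw [Complex.add_re]
      linarith

lemma A_real (ψ : AddChar F ℂ) (a b : F) : ∃ k : ℝ, LF.A ψ a b 1 = k := by
  have : (starRingEnd ℂ) (LF.A ψ a b 1) = LF.A ψ a b 1 := by
    rw [LF.A_one, map_sum, ← Equiv.sum_comp (Equiv.neg F)]
    refine Finset.sum_congr rfl fun x _ => ?_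
    simp only [Equiv.neg_apply, neg_eq_zero]
    split_ifs
    · simp
    · rw [← AddChar.map_neg_eq_conj]; congr 1; rw [inv_neg]; ring
  obtain ⟨k, hk⟩ := Complex.conj_eq_iff_real.1 this
  exact ⟨k, hk⟩

theorem kloosterman (hodd : Odd (Fintype.card F))
    {ψ : AddChar F ℂ} (hψ : ψ.IsPrimitive) {a b : F} (ha : a ≠ 0) (hb : b ≠ 0) :
    ‖∑ x : F, if x = 0 then 0 else ψ (a * x + b * x⁻¹)‖ ≤ 2 * Real.sqrt (Fintype.card F) := by
  rw [← LF.A_one]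
  obtain ⟨p, hpc⟩ := CharP.exists F
  have : Fact p.Prime := ⟨(CharP.char_is_prime F p)⟩
  choose k hk using fun c : F => A_real ψ (c * a) (c * b)
  choose α β h1 h2 h3 h4 using fun c : F => root_ex (k c) (Fintype.card F)
  set q := Fintype.card F with hq
  have hq0 : 0 < (q : ℝ) := by exact_mod_cast Fintype.card_pos
  by_contra hcon
  push Not at hcon
  have hk1 : LF.A ψ a b 1 = k 1 := by have := hk 1; rwa [one_mul, one_mul] at this
  rw [hk1, Complex.norm_real, Real.norm_eq_abs] at hcon
  have hbig : 4 * (q : ℝ) < (k 1) ^ 2 := by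
    rw [← sq_abs]
    have h5 : (0:ℝ) ≤ 2 * Real.sqrt q := by positivity
    have h6 := pow_lt_pow_left₀ hcon h5 two_ne_zero
    rw [mul_pow, Real.sq_sqrt hq0.le] at h6
    linarith
  obtain ⟨θ, hθ, hθN⟩ := h4 1 hbig
  have key : ∀ m : ℕ, 1 ≤ m → θ ^ (p * m) ≤ 4 * q * (q : ℝ) ^ (p * m) := by
    intro m hm
    have hmain := main_ineq p hodd hψ ha hb m hm
    have hN : 2 * (p * m) = (2 * (p * m) - 1) + 1 := by
      have : 0 < p * m := Nat.mul_pos (Fact.out : p.Prime).pos hm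
      omega
    have hkap : ∀ c ∈ Finset.univ.erase (0 : F), LF.kap ψ (c * a) (c * b) (2 * (p * m)) =
        - (α c ^ (2 * (p * m)) + β c ^ (2 * (p * m))) := by
      intro c hc
      have hc0 := Finset.ne_of_mem_erase hc
      rw [hN]
      exact LF.kap_closed hψ (mul_ne_zero hc0 ha) (mul_ne_zero hc0 hb) _ _ (by rw [h1, hk]) (h2 c) _
    rw [Finset.sum_congr rfl hkap, Finset.sum_neg_distrib, neg_neg, Complex.re_sum,
      ← Finset.add_sum_erase _ _ (Finset.mem_erase.2 ⟨one_ne_zero, Finset.mem_univ (1 : F)⟩)] at hmain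
    have h5 := hθN (p * m)
    have h6 : - (2 * q * (q : ℝ) ^ (p * m)) ≤ ∑ c ∈ (Finset.univ.erase (0 : F)).erase 1,
        (α c ^ (2 * (p * m)) + β c ^ (2 * (p * m))).re := by
      have h7 := Finset.card_nsmul_le_sum ((Finset.univ.erase (0 : F)).erase 1)
        (fun c => (α c ^ (2 * (p * m)) + β c ^ (2 * (p * m))).re) _ (fun c _ => h3 c (p * m))
      refine le_trans ?_ h7
      rw [nsmul_eq_mul]
      have h8 : (((Finset.univ.erase (0 : F)).erase 1).card : ℝ) ≤ q := by
        exact_mod_cast Finset.card_le_univ _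
      have h9 : 0 ≤ (q : ℝ) ^ (p * m) := by positivity
      nlinarith
    linarith
  have hlim : Filter.Tendsto (fun m : ℕ => (θ / q) ^ m) Filter.atTop Filter.atTop :=
    tendsto_pow_atTop_atTop_of_one_lt ((one_lt_div hq0).2 hθ)
  obtain ⟨m0, hm0⟩ := (hlim.eventually_gt_atTop (4 * (q : ℝ))).exists_forall_of_atTop
  have h10 := hm0 (p * (m0 + 1)) (by nlinarith [(Fact.out : p.Prime).one_lt])
  have h11 := key (m0 + 1) (by omega)
  rw [div_pow, lt_div_iff₀ (by positivity)] at h10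
  linarith

end KL

namespace SP
variable {F : Type} [Field F] [Fintype F] [DecidableEq F]
open scoped Matrix

noncomputable def η (F : Type) [Field F] [Fintype F] [DecidableEq F] : MulChar F ℂ :=
  (quadraticChar F).ringHomComp (Int.castRingHom ℂ)

lemma sum_prod {d : ℕ} (h : Fin d → F → ℂ) : ∑ x : Fin d → F, ∏ j, h j (x j) = ∏ j, ∑ y : F, h j y := by
  rw [Finset.prod_univ_sum, Fintype.piFinset_univ]

lemma char_sum {ψ : AddChar F ℂ} {d : ℕ} (v : Fin d → F) : ψ (∑ j, v j) = ∏ j, ψ (v j) := by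
  induction d with
  | zero => simp
  | succ d ih => rw [Fin.sum_univ_succ, Fin.prod_univ_succ, AddChar.map_add_eq_mul, ih]

lemma orth {ψ : AddChar F ℂ} (hψ : ψ.IsPrimitive) {d : ℕ} (x : Fin d → F) :
    ∑ m : Fin d → F, ψ (m ⬝ᵥ x) = if x = 0 then (Fintype.card F : ℂ) ^ d else 0 := by
  simp only [dotProduct, char_sum]
  rw [sum_prod (fun j y => ψ (y * x j))]
  simp only [AddChar.sum_mulShift _ hψ]
  split_ifs with h
  · subst h; simp
  · obtain ⟨j, hj⟩ := Function.ne_iff.1 h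
    apply Finset.prod_eq_zero (Finset.mem_univ j)
    rw [if_neg (show x j ≠ 0 from hj), Nat.cast_zero]

lemma two_ne (hodd : Odd (Fintype.card F)) : ringChar F ≠ 2 := by
  intro h
  have := FiniteField.even_card_of_char_two h
  rw [Nat.odd_iff] at hodd
  omega

lemma two_ne' (hodd : Odd (Fintype.card F)) : (2 : F) ≠ 0 :=
  Ring.two_ne_zero (two_ne hodd)

lemma four_ne' (hodd : Odd (Fintype.card F)) : (4 : F) ≠ 0 := by
  have : (4 : F) = 2 * 2 := by norm_num
  rw [this]; exact mul_ne_zero (two_ne' hodd) (two_ne' hodd)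

lemma eta_ne_one (hodd : Odd (Fintype.card F)) : η F ≠ 1 := by
  rw [η, MulChar.ringHomComp_ne_one_iff (Int.cast_injective)]
  exact quadraticChar_ne_one (two_ne hodd)

lemma eta_quad : (η F).IsQuadratic := (quadraticChar_isQuadratic F).comp _

lemma eta_sq {s : F} (hs : s ≠ 0) : η F s ^ 2 = 1 := by
  rw [η, MulChar.ringHomComp_apply, ← map_pow, quadraticChar_sq_one hs, map_one]

lemma eta_norm {s : F} (hs : s ≠ 0) : ‖η F s‖ = 1 := by
  have h := congrArg norm (eta_sq hs)
  rw [norm_pow, norm_one] at h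
  exact (pow_eq_one_iff_of_nonneg (norm_nonneg _) two_ne_zero).1 h

lemma gauss_norm (hodd : Odd (Fintype.card F)) {ψ : AddChar F ℂ} (hψ : ψ.IsPrimitive) :
    ‖gaussSum (η F) ψ‖ = Real.sqrt (Fintype.card F) := by
  have h := congrArg norm (gaussSum_sq (eta_ne_one hodd) eta_quad hψ)
  rw [norm_pow, norm_mul, eta_norm (neg_ne_zero.2 one_ne_zero), one_mul, Complex.norm_natCast] at h
  rw [← h, Real.sqrt_sq (norm_nonneg _)]

lemma gauss_mul (ψ : AddChar F ℂ) {s : F} (hs : s ≠ 0) :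
    ∑ u : F, η F u * ψ (s * u) = η F s * gaussSum (η F) ψ := by
  have h := gaussSum_mulShift (η F) ψ (Units.mk0 s hs)
  rw [Units.val_mk0] at h
  rw [← h, ← mul_assoc, ← pow_two, eta_sq hs, one_mul]
  simp [gaussSum, AddChar.mulShift_apply]

lemma quad_sum (hodd : Odd (Fintype.card F)) {ψ : AddChar F ℂ} (hψ : ψ.IsPrimitive) {s : F} (hs : s ≠ 0) :
    ∑ x : F, ψ (s * x ^ 2) = η F s * gaussSum (η F) ψ := by
  rw [← gauss_mul ψ hs]
  have h1 : ∀ x : F, ψ (s * x ^ 2) = ∑ u : F, if x ^ 2 = u then ψ (s * u) else 0 := by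
    intro x; simp
  simp only [h1]
  rw [Finset.sum_comm]
  have h2 : ∀ u : F, (∑ x : F, if x ^ 2 = u then ψ (s * u) else 0) = ψ (u * s) + η F u * ψ (s * u) := by
    intro u
    rw [← Finset.sum_filter, Finset.sum_const, nsmul_eq_mul]
    have h3 := quadraticChar_card_sqrts (two_ne hodd) u
    have h4 : (Finset.univ.filter fun x : F => x ^ 2 = u) = {x : F | x ^ 2 = u}.toFinset := by ext; simp
    rw [← h4] at h3
    have h5 := congrArg (Int.cast : ℤ → ℂ) h3
    rw [Int.cast_natCast] at h5
    rw [h5, η, MulChar.ringHomComp_apply, mul_comm u s]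
    push_cast
    rw [eq_intCast]
    ring
  simp only [h2]
  rw [Finset.sum_add_distrib, AddChar.sum_mulShift _ hψ, if_neg hs]
  simp

lemma quad_lin_sum (hodd : Odd (Fintype.card F)) {ψ : AddChar F ℂ} (hψ : ψ.IsPrimitive) {s : F} (hs : s ≠ 0) (m : F) :
    ∑ x : F, ψ (s * x ^ 2 + m * x) = ψ (- (m ^ 2 / (4 * s))) * (η F s * gaussSum (η F) ψ) := by
  rw [← quad_sum hodd hψ hs, ← Equiv.sum_comp (Equiv.addRight (- (m / (2 * s)))), Finset.mul_sum]
  refine Finset.sum_congr rfl fun x _ => ?_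
  rw [← AddChar.map_add_eq_mul, Equiv.coe_addRight]
  congr 1
  have := two_ne' hodd
  have := four_ne' hodd
  field_simp
  ring

noncomputable def T (ψ : AddChar F ℂ) (d : ℕ) (t M : F) : ℂ :=
  ∑ s : F, if s = 0 then 0 else η F s ^ d * ψ (- (s * t) - M / (4 * s))

noncomputable def Sh (ψ : AddChar F ℂ) {d : ℕ} (t : F) (m : Fin d → F) : ℂ :=
  ∑ x : Fin d → F, (if ∑ j, x j ^ 2 = t then (1 : ℂ) else 0) * ψ (m ⬝ᵥ x)

lemma sphere_hat (hodd : Odd (Fintype.card F)) {ψ : AddChar F ℂ} (hψ : ψ.IsPrimitive) {d : ℕ} (t : F)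
    (m : Fin d → F) (hm : m ≠ 0) :
    Fintype.card F * Sh ψ t m = gaussSum (η F) ψ ^ d * T ψ d t (∑ j, m j ^ 2) := by
  have h1 : ∀ x : Fin d → F, (Fintype.card F : ℂ) * ((if ∑ j, x j ^ 2 = t then (1 : ℂ) else 0) * ψ (m ⬝ᵥ x)) =
      ∑ s : F, ψ (s * (∑ j, x j ^ 2 - t)) * ψ (m ⬝ᵥ x) := by
    intro x
    rw [← Finset.sum_mul, AddChar.sum_mulShift _ hψ, ← mul_assoc]
    congr 1
    simp only [sub_eq_zero]
    split_ifs <;> simp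
  rw [Sh, Finset.mul_sum]
  simp only [h1]
  rw [Finset.sum_comm, T, Finset.mul_sum]
  refine Finset.sum_congr rfl fun s _ => ?_
  by_cases hs : s = 0
  · subst hs
    simp only [zero_mul, AddChar.map_zero_eq_one, one_mul, if_true, mul_zero]
    simp only [dotProduct_comm m]
    rw [orth hψ, if_neg hm]
  · rw [if_neg hs]
    have h2 : ∀ x : Fin d → F, ψ (s * (∑ j, x j ^ 2 - t)) * ψ (m ⬝ᵥ x) =
        ψ (-(s * t)) * ∏ j, ψ (s * x j ^ 2 + m j * x j) := by
      intro x
      rw [← char_sum, ← AddChar.map_add_eq_mul, ← AddChar.map_add_eq_mul]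
      congr 1
      rw [Finset.sum_add_distrib, ← Finset.mul_sum, dotProduct]
      ring
    simp only [h2]
    rw [← Finset.mul_sum, sum_prod (fun j y => ψ (s * y ^ 2 + m j * y))]
    simp only [quad_lin_sum hodd hψ hs]
    rw [Finset.prod_mul_distrib, ← char_sum, Finset.prod_const, Finset.card_univ, Fintype.card_fin, sub_eq_add_neg,
      AddChar.map_add_eq_mul, Finset.sum_neg_distrib, Finset.sum_div]
    ring

lemma q_pos : (0 : ℝ) < Fintype.card F := by exact_mod_cast Fintype.card_pos

lemma one_le_sqrt : 1 ≤ Real.sqrt (Fintype.card F) := by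
  rw [Real.one_le_sqrt]; exact_mod_cast Fintype.card_pos

lemma salie (hodd : Odd (Fintype.card F)) {ψ : AddChar F ℂ} (hψ : ψ.IsPrimitive) (e : F) :
    ‖T ψ 1 e 1‖ ≤ 2 * Real.sqrt (Fintype.card F) := by
  have h := sphere_hat hodd hψ (d := 1) e (fun _ => 1) (by intro h; exact one_ne_zero (congrFun h 0))
  have hs : ‖Sh ψ e (fun _ : Fin 1 => (1 : F))‖ ≤ 2 := by
    rw [Sh]
    refine (norm_sum_le _ _).trans ?_
    have : ∀ x : Fin 1 → F, ‖(if ∑ j, x j ^ 2 = e then (1 : ℂ) else 0) * ψ ((fun _ : Fin 1 => (1 : F)) ⬝ᵥ x)‖ =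
        if x 0 ^ 2 = e then 1 else 0 := by
      intro x
      rw [norm_mul, AddChar.norm_apply, mul_one, Fin.sum_univ_one]
      split_ifs <;> simp
    simp only [this]
    rw [← Equiv.sum_comp (Equiv.funUnique (Fin 1) F).symm]
    have h4 : (Finset.univ.filter fun x : F => x ^ 2 = e) = {x : F | x ^ 2 = e}.toFinset := by ext; simp
    have h3 := quadraticChar_card_sqrts (two_ne hodd) e
    rw [← h4] at h3
    simp only [Equiv.funUnique_symm_apply, uniqueElim_const]
    rw [Finset.sum_boole]
    have h5 : quadraticChar F e ≤ 1 := by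
      rcases quadraticChar_isQuadratic F e with h | h | h <;> rw [h] <;> norm_num
    have h6 : ((Finset.univ.filter fun x : F => x ^ 2 = e).card : ℤ) ≤ 2 := by rw [h3]; linarith
    exact_mod_cast h6
  have h' := congrArg norm h
  rw [norm_mul, norm_mul, pow_one, gauss_norm hodd hψ, Complex.norm_natCast] at h'
  simp only [Fin.sum_univ_one, one_pow] at h'
  have hq := Real.mul_self_sqrt (q_pos (F := F)).le
  have hpos : 0 < Real.sqrt (Fintype.card F) := Real.sqrt_pos.2 q_pos
  refine le_of_mul_le_mul_left ?_ hpos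
  rw [← h']
  nlinarith [q_pos (F := F)]

lemma T_bound (hodd : Odd (Fintype.card F)) {ψ : AddChar F ℂ} (hψ : ψ.IsPrimitive) (d : ℕ) {t : F} (ht : t ≠ 0) (M : F) :
    ‖T ψ d t M‖ ≤ 2 * Real.sqrt (Fintype.card F) := by
  have h1 := one_le_sqrt (F := F)
  have h4 := four_ne' hodd
  rcases Nat.even_or_odd d with hd | hd
  · have hT : T ψ d t M = ∑ s : F, if s = 0 then 0 else ψ ((-t) * s + (-(M / 4)) * s⁻¹) := by
      refine Finset.sum_congr rfl fun s _ => ?_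
      split_ifs with hs
      · rfl
      · obtain ⟨k, rfl⟩ := hd
        rw [← two_mul, pow_mul, eta_sq hs, one_pow, one_mul]
        congr 1
        field_simp
        ring
    rw [hT]
    by_cases hM : M = 0
    · have : (∑ s : F, if s = 0 then 0 else ψ ((-t) * s + (-(M / 4)) * s⁻¹)) = -1 := by
        have h := AddChar.sum_mulShift (-t) hψ
        rw [if_neg (neg_ne_zero.2 ht), ← Finset.add_sum_erase _ _ (Finset.mem_univ (0 : F)), zero_mul,
          AddChar.map_zero_eq_one, Nat.cast_zero] at h
        rw [← Finset.add_sum_erase _ _ (Finset.mem_univ (0 : F)), if_pos rfl, zero_add]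
        rw [← eq_neg_iff_add_eq_zero.2 ((add_comm _ _).trans h)]
        refine Finset.sum_congr rfl fun s hs => ?_
        rw [if_neg (Finset.ne_of_mem_erase hs), hM]
        congr 1; ring
      rw [this, norm_neg, norm_one]
      linarith
    · exact KL.kloosterman hodd hψ (neg_ne_zero.2 ht) (neg_ne_zero.2 (div_ne_zero hM h4))
  · have hT : T ψ d t M = T ψ 1 t M := by
      refine Finset.sum_congr rfl fun s _ => ?_
      split_ifs with hs
      · rfl
      · obtain ⟨k, rfl⟩ := hd
        rw [pow_succ, pow_mul, eta_sq hs, one_pow, one_mul, pow_one]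
    rw [hT]
    by_cases hM : M = 0
    · have : T ψ 1 t M = ∑ u : F, η F u * ψ ((-t) * u) := by
        refine Finset.sum_congr rfl fun s _ => ?_
        split_ifs with hs
        · subst hs; rw [MulChar.map_zero, zero_mul]
        · rw [pow_one, hM]; congr 2; ring
      rw [this, gauss_mul ψ (neg_ne_zero.2 ht), norm_mul, eta_norm (neg_ne_zero.2 ht), gauss_norm hodd hψ]
      linarith
    · have : T ψ 1 t M = η F M * T ψ 1 (M * t) 1 := by
        rw [T, T, Finset.mul_sum, ← Equiv.sum_comp (Equiv.mulLeft₀ M hM)]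
        refine Finset.sum_congr rfl fun s _ => ?_
        change (if M * s = 0 then 0 else η F (M * s) ^ 1 * ψ (-(M * s * t) - M / (4 * (M * s)))) = _
        simp only [mul_eq_zero, hM, false_or]
        split_ifs with hs
        · simp
        · rw [pow_one, pow_one, map_mul, mul_assoc]
          congr 3
          field_simp
      rw [this, norm_mul, eta_norm hM, one_mul]
      exact salie hodd hψ _

lemma Sh_bound (hodd : Odd (Fintype.card F)) {ψ : AddChar F ℂ} (hψ : ψ.IsPrimitive) {d : ℕ} {t : F} (ht : t ≠ 0)
    (m : Fin d → F) (hm : m ≠ 0) : ‖Sh ψ t m‖ ≤ 2 * (Fintype.card F : ℝ) ^ (((d : ℝ) - 1) / 2) := by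
  have h := congrArg norm (sphere_hat hodd hψ t m hm)
  rw [norm_mul, norm_mul, norm_pow, gauss_norm hodd hψ, Complex.norm_natCast] at h
  have hT := T_bound hodd hψ d ht (∑ j, m j ^ 2)
  have hq := q_pos (F := F)
  refine le_of_mul_le_mul_left ?_ hq
  rw [h]
  have e : (Fintype.card F : ℝ) * (2 * (Fintype.card F : ℝ) ^ (((d : ℝ) - 1) / 2)) =
      Real.sqrt (Fintype.card F) ^ d * (2 * Real.sqrt (Fintype.card F)) := by
    rw [Real.sqrt_eq_rpow, ← Real.rpow_natCast, ← Real.rpow_mul hq.le]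
    have h1 : (Fintype.card F : ℝ) * (2 * (Fintype.card F : ℝ) ^ (((d : ℝ) - 1) / 2)) =
      2 * ((Fintype.card F : ℝ) ^ (1 : ℝ) * (Fintype.card F : ℝ) ^ (((d : ℝ) - 1) / 2)) := by rw [Real.rpow_one]; ring
    have h2 : (Fintype.card F : ℝ) ^ (1 / 2 * (d : ℝ)) * (2 * (Fintype.card F : ℝ) ^ (1 / 2 : ℝ)) =
      2 * ((Fintype.card F : ℝ) ^ (1 / 2 * (d : ℝ)) * (Fintype.card F : ℝ) ^ (1 / 2 : ℝ)) := by ring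
    rw [h1, h2, ← Real.rpow_add hq, ← Real.rpow_add hq]
    congr 2; ring
  rw [e]
  exact mul_le_mul_of_nonneg_left hT (by positivity)

noncomputable def ft (ψ : AddChar F ℂ) {d : ℕ} (k : (Fin d → F) → ℂ) (m : Fin d → F) : ℂ :=
  ∑ x, k x * ψ (m ⬝ᵥ x)

lemma ft_inv {ψ : AddChar F ℂ} (hψ : ψ.IsPrimitive) {d : ℕ} (k : (Fin d → F) → ℂ) (z : Fin d → F) :
    ∑ m, ft ψ k m * ψ (-(m ⬝ᵥ z)) = (Fintype.card F : ℂ) ^ d * k z := by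
  have h : ∀ m, ft ψ k m * ψ (-(m ⬝ᵥ z)) = ∑ x, k x * ψ (m ⬝ᵥ (x - z)) := by
    intro m
    rw [ft, Finset.sum_mul]
    refine Finset.sum_congr rfl fun x _ => ?_
    rw [mul_assoc, ← AddChar.map_add_eq_mul, dotProduct_sub, sub_eq_add_neg]
  simp only [h]
  rw [Finset.sum_comm]
  simp only [← Finset.mul_sum, orth hψ, sub_eq_zero]
  simp [mul_comm]

lemma ft_bil {ψ : AddChar F ℂ} (hψ : ψ.IsPrimitive) {d : ℕ} (k : (Fin d → F) → ℂ) (f g : (Fin d → F) → ℝ) :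
    (Fintype.card F : ℂ) ^ d * ∑ x, ∑ y, (f x : ℂ) * g y * k (x - y) =
      ∑ m, ft ψ k m * ((starRingEnd ℂ) (ft ψ (fun x => (f x : ℂ)) m) * ft ψ (fun x => (g x : ℂ)) m) := by
  have h : ∀ m, ft ψ k m * ((starRingEnd ℂ) (ft ψ (fun x => (f x : ℂ)) m) * ft ψ (fun x => (g x : ℂ)) m) =
      ∑ x, ∑ y, (f x : ℂ) * g y * (ft ψ k m * ψ (-(m ⬝ᵥ (x - y)))) := by
    intro m
    rw [ft.eq_def ψ (fun x => (f x : ℂ)), ft.eq_def ψ (fun x => (g x : ℂ)), map_sum, Finset.sum_mul_sum, Finset.mul_sum]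
    refine Finset.sum_congr rfl fun x _ => ?_
    rw [Finset.mul_sum]
    refine Finset.sum_congr rfl fun y _ => ?_
    rw [map_mul, Complex.conj_ofReal, ← AddChar.map_neg_eq_conj]
    have : -(m ⬝ᵥ (x - y)) = -(m ⬝ᵥ x) + m ⬝ᵥ y := by rw [dotProduct_sub]; ring
    rw [this, AddChar.map_add_eq_mul]
    ring
  simp only [h]
  symm
  rw [Finset.sum_comm, Finset.mul_sum]
  refine Finset.sum_congr rfl fun x _ => ?_
  rw [Finset.sum_comm, Finset.mul_sum]
  refine Finset.sum_congr rfl fun y _ => ?_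
  rw [← Finset.mul_sum, ft_inv hψ]
  ring

lemma plancherel {ψ : AddChar F ℂ} (hψ : ψ.IsPrimitive) {d : ℕ} (f : (Fin d → F) → ℝ) :
    ∑ m, ‖ft ψ (fun x => (f x : ℂ)) m‖ ^ 2 = (Fintype.card F : ℝ) ^ d * ∑ x, f x ^ 2 := by
  have h := ft_bil hψ (fun z : Fin d → F => if z = 0 then (1 : ℂ) else 0) f f
  have h1 : ∀ m : Fin d → F, ft ψ (fun z : Fin d → F => if z = 0 then (1 : ℂ) else 0) m = 1 := by
    intro m; simp [ft]
  simp only [h1, one_mul, Complex.conj_mul', sub_eq_zero] at h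
  simp only [mul_ite, mul_one, mul_zero, Finset.sum_ite_eq, Finset.mem_univ, if_true] at h
  have h2 : (((Fintype.card F : ℝ) ^ d * ∑ x, f x * f x : ℝ) : ℂ) = ((∑ m, ‖ft ψ (fun x => (f x : ℂ)) m‖ ^ 2 : ℝ) : ℂ) := by
    push_cast; exact h
  have h3 := Complex.ofReal_injective h2
  rw [← h3]
  simp only [pow_two]

theorem main (hodd : Odd (Fintype.card F)) (d : ℕ) (t : F) (ht : t ≠ 0) (f g : (Fin d → F) → ℝ) :
    |(∑ x : Fin d → F, ∑ y : Fin d → F,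
          f x * g y * (if ∑ j, (x j - y j) ^ 2 = t then (1 : ℝ) else 0)) -
        (((Finset.univ.filter (fun x : Fin d → F => ∑ j, (x j) ^ 2 = t)).card : ℝ) / (Fintype.card F : ℝ) ^ d) *
          (∑ x : Fin d → F, f x) * (∑ y : Fin d → F, g y)| ≤ 2 * (Fintype.card F : ℝ) ^ (((d : ℝ) - 1) / 2) *
        Real.sqrt (∑ x : Fin d → F, f x ^ 2) * Real.sqrt (∑ y : Fin d → F, g y ^ 2) := by
  have hψ : (AddChar.FiniteField.primitiveChar_to_Complex F).IsPrimitive := AddChar.FiniteField.primitiveChar_to_Complex_isPrimitive F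
  set ψ := AddChar.FiniteField.primitiveChar_to_Complex F
  set B := 2 * (Fintype.card F : ℝ) ^ (((d : ℝ) - 1) / 2) with hB
  have hB0 : 0 ≤ B := by positivity
  have hq : (0 : ℝ) < (Fintype.card F : ℝ) ^ d := pow_pos q_pos d
  set X := (∑ x : Fin d → F, ∑ y : Fin d → F,
          f x * g y * (if ∑ j, (x j - y j) ^ 2 = t then (1 : ℝ) else 0)) with hX
  set c : ℝ := ((Finset.univ.filter (fun x : Fin d → F => ∑ j, (x j) ^ 2 = t)).card : ℝ) with hc
  set k : (Fin d → F) → ℂ := fun x => if ∑ j, x j ^ 2 = t then (1 : ℂ) else 0 with hk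
  set fh := ft ψ (fun x => (f x : ℂ)) with hfh
  set gh := ft ψ (fun x => (g x : ℂ)) with hgh
  have h := ft_bil hψ k f g
  have hXc : (∑ x, ∑ y, (f x : ℂ) * g y * k (x - y)) = (X : ℂ) := by
    rw [hX]; push_cast
    simp only [hk, Pi.sub_apply]
    refine Finset.sum_congr rfl fun x _ => Finset.sum_congr rfl fun y _ => ?_
    congr 1
    split_ifs <;> simp
  rw [hXc, ← Finset.add_sum_erase _ _ (Finset.mem_univ (0 : Fin d → F))] at h
  have h0 : ft ψ k 0 * ((starRingEnd ℂ) (fh 0) * gh 0) = ((c * ((∑ x, f x) * ∑ y, g y) : ℝ) : ℂ) := by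
    have e1 : ft ψ k 0 = (c : ℂ) := by
      rw [ft, hc]; simp [hk]
    have e2 : ∀ f : (Fin d → F) → ℝ, ft ψ (fun x => (f x : ℂ)) 0 = ((∑ x, f x : ℝ) : ℂ) := by
      intro f; simp [ft]
    rw [e1, hfh, hgh, e2, e2, Complex.conj_ofReal]
    push_cast; ring
  rw [h0] at h
  set R := ∑ m ∈ Finset.univ.erase (0 : Fin d → F), ft ψ k m * ((starRingEnd ℂ) (fh m) * gh m) with hR
  have hRn : ‖R‖ ≤ B * ((Fintype.card F : ℝ) ^ d * (Real.sqrt (∑ x, f x ^ 2) * Real.sqrt (∑ y, g y ^ 2))) := by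
    calc ‖R‖ ≤ ∑ m ∈ Finset.univ.erase (0 : Fin d → F), ‖ft ψ k m * ((starRingEnd ℂ) (fh m) * gh m)‖ := norm_sum_le _ _
      _ ≤ ∑ m ∈ Finset.univ.erase (0 : Fin d → F), B * (‖fh m‖ * ‖gh m‖) := by
        refine Finset.sum_le_sum fun m hm => ?_
        rw [norm_mul, norm_mul, RCLike.norm_conj]
        exact mul_le_mul_of_nonneg_right (Sh_bound hodd hψ ht m (Finset.ne_of_mem_erase hm)) (by positivity)
      _ ≤ ∑ m, B * (‖fh m‖ * ‖gh m‖) :=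
        Finset.sum_le_sum_of_subset_of_nonneg (Finset.erase_subset _ _) (fun m _ _ => by positivity)
      _ = B * ∑ m, ‖fh m‖ * ‖gh m‖ := by rw [Finset.mul_sum]
      _ ≤ B * (Real.sqrt (∑ m, ‖fh m‖ ^ 2) * Real.sqrt (∑ m, ‖gh m‖ ^ 2)) :=
        mul_le_mul_of_nonneg_left (Real.sum_mul_le_sqrt_mul_sqrt _ _ _) hB0
      _ = _ := by
        rw [plancherel hψ, plancherel hψ, Real.sqrt_mul hq.le, Real.sqrt_mul hq.le]
        have := Real.mul_self_sqrt hq.le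
        linear_combination B * Real.sqrt (∑ x, f x ^ 2) * Real.sqrt (∑ y, g y ^ 2) * this
  have hRe : R = (((Fintype.card F : ℝ) ^ d * (X - c / (Fintype.card F : ℝ) ^ d * (∑ x, f x) * ∑ y, g y) : ℝ) : ℂ) := by
    have e : (Fintype.card F : ℝ) ^ d * (X - c / (Fintype.card F : ℝ) ^ d * (∑ x, f x) * ∑ y, g y) =
      (Fintype.card F : ℝ) ^ d * X - c * ((∑ x, f x) * ∑ y, g y) := by field_simp
    rw [e, Complex.ofReal_sub, Complex.ofReal_mul, Complex.ofReal_pow, Complex.ofReal_natCast]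
    linear_combination -h
  rw [hRe, Complex.norm_real, Real.norm_eq_abs, abs_mul, abs_of_pos hq] at hRn
  refine le_of_mul_le_mul_left ?_ hq
  linarith

end SP

theorem statement5 {F : Type} [Field F] [Fintype F] [DecidableEq F]
    (q : ℕ) (hq : Fintype.card F = q) (hodd : Odd q)
    (d : ℕ) (hd : 2 ≤ d)
    (t : F) (ht : t ≠ 0)
    (f g : (Fin d → F) → ℝ) (hf : ∀ x, 0 ≤ f x) (hg : ∀ x, 0 ≤ g x) :
    ∃ D : ℝ,
      (∑ x : Fin d → F, ∑ y : Fin d → F,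
          f x * g y * (if ∑ j, (x j - y j) ^ 2 = t then (1 : ℝ) else 0)) =
        (((Finset.univ.filter (fun x : Fin d → F => ∑ j, (x j) ^ 2 = t)).card : ℝ) / (q : ℝ) ^ d) *
          (∑ x : Fin d → F, f x) * (∑ y : Fin d → F, g y) + D ∧
      |D| ≤ 2 * (q : ℝ) ^ (((d : ℝ) - 1) / 2) *
        Real.sqrt (∑ x : Fin d → F, f x ^ 2) * Real.sqrt (∑ y : Fin d → F, g y ^ 2) := by
  subst hq
  exact ⟨_, by ring, SP.main hodd d t ht f g⟩
end
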